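/- For each pairing relation R on E = {±e_1, ±e_2, ±e_3}, the covering Ĉ_R satisfies the local isomorphism property if and only if R satisfies condition (P). -/

import Mathlib

namespace Folding

noncomputable section

open Set

/-- Points of `ℝ^n` with the euclidean distance. -/
abbrev Pt (n : ℕ) := EuclideanSpace ℝ (Fin n)

/-- `p` is a point of the lattice `ℤ^n`. -/
def latt {n : ℕ} (p : Pt n) : Prop := ∀ i, ∃ m : ℤ, p i = (m : ℝ)

/-- `p` belongs to `m·ℤ^n`. -/
def inLat {n : ℕ} (m : ℕ) (p : Pt n) : Prop := ∀ i, ∃ c : ℤ, p i = (m : ℝ) * (c : ℝ)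

/-- The canonical basis vector `e_i`. -/
def uvec (n : ℕ) (i : Fin n) : Pt n := EuclideanSpace.single i (1 : ℝ)

/-- `u` belongs to `E = {e_1, -e_1, …, e_n, -e_n}`. -/
def IsDir {n : ℕ} (u : Pt n) : Prop := ∃ i, u = uvec n i ∨ u = -uvec n i

/-- A (nonoriented) lattice segment `[x, x + e_i]`, as an unordered pair of endpoints. -/
def IsSeg {n : ℕ} (S : Sym2 (Pt n)) : Prop := ∃ x i, latt x ∧ S = s(x, x + uvec n i)

/-- A curve: a sequence of segments, indexed by an interval of `ℤ` (finite, ℕ-like or ℤ-like),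
recorded through its sequence of vertices; two consecutive segments have exactly one common
endpoint, and the common endpoints with the preceding and the following segments differ
(`noback`). -/
structure Curve (n : ℕ) where
  dom : Set ℤ
  ordConn : dom.OrdConnected
  nontriv : ∃ i, i ∈ dom ∧ i + 1 ∈ dom
  v : ℤ → Pt n
  lattice : ∀ i ∈ dom, latt (v i)
  step : ∀ i : ℤ, i ∈ dom → i + 1 ∈ dom →
    ∃ j, v (i + 1) = v i + uvec n j ∨ v (i + 1) = v i - uvec n j
  noback : ∀ i : ℤ, i - 1 ∈ dom → i + 1 ∈ dom → v (i + 1) ≠ v (i - 1)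

namespace Curve

variable {n : ℕ} (c : Curve n)

/-- The segments of a curve. -/
def segs : Set (Sym2 (Pt n)) :=
  {S | ∃ i : ℤ, i ∈ c.dom ∧ i + 1 ∈ c.dom ∧ S = s(c.v i, c.v (i + 1))}

/-- The connexions between segments of a curve: pairs of consecutive segments. -/
def conn (S T : Sym2 (Pt n)) : Prop :=
  ∃ i : ℤ, i - 1 ∈ c.dom ∧ i + 1 ∈ c.dom ∧
    ((S = s(c.v (i - 1), c.v i) ∧ T = s(c.v i, c.v (i + 1))) ∨
     (T = s(c.v (i - 1), c.v i) ∧ S = s(c.v i, c.v (i + 1))))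

/-- A curve is self-avoiding if each of its segments appears only once. -/
def SelfAvoiding : Prop :=
  ∀ i j : ℤ, i ∈ c.dom → i + 1 ∈ c.dom → j ∈ c.dom → j + 1 ∈ c.dom →
    s(c.v i, c.v (i + 1)) = s(c.v j, c.v (j + 1)) → i = j

/-- A curve without endpoints (indexed by `ℤ`). -/
def NoEndpts : Prop := c.dom = Set.univ

/-- `p` is an endpoint of the curve `c`. -/
def IsEndpt (p : Pt n) : Prop :=
  ∃ i ∈ c.dom, p = c.v i ∧ (i - 1 ∉ c.dom ∨ i + 1 ∉ c.dom)

/-- `S` is the end segment of `c` at its endpoint `p`. -/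
def endSegAt (p : Pt n) (S : Sym2 (Pt n)) : Prop :=
  ∃ i : ℤ, i ∈ c.dom ∧ p = c.v i ∧
    ((i - 1 ∉ c.dom ∧ i + 1 ∈ c.dom ∧ S = s(c.v i, c.v (i + 1))) ∨
     (i + 1 ∉ c.dom ∧ i - 1 ∈ c.dom ∧ S = s(c.v (i - 1), c.v i)))

/-- The number of segments (length) of a curve. -/
def nsegs : ℕ := {i : ℤ | i ∈ c.dom ∧ i + 1 ∈ c.dom}.ncard

end Curve

/-- The trace of a set of curves: its set of segments together with the connexion
relation between segments.  Two sets of curves are geometrically the same set of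
(nonoriented) curves iff they have the same trace. -/
structure Trace (n : ℕ) where
  segs : Set (Sym2 (Pt n))
  conn : Sym2 (Pt n) → Sym2 (Pt n) → Prop

def curveTrace {n : ℕ} (c : Curve n) : Trace n := ⟨c.segs, c.conn⟩

def traceOf {n : ℕ} (E : Set (Curve n)) : Trace n :=
  ⟨{S | ∃ c ∈ E, S ∈ c.segs}, fun S T => ∃ c ∈ E, c.conn S T⟩

/-- Two curves are the same nonoriented curve. -/
def SameCurve {n : ℕ} (c d : Curve n) : Prop := c.segs = d.segs ∧ c.conn = d.conn

/-- A set of pairwise disjoint self-avoiding curves. -/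
def DisjSA {n : ℕ} (E : Set (Curve n)) : Prop :=
  (∀ c ∈ E, c.SelfAvoiding) ∧
  ∀ c ∈ E, ∀ d ∈ E, ¬ SameCurve c d → ∀ S, S ∈ c.segs → S ∉ d.segs

/-- The set of points of `ℝ^n` lying on the segment `S`. -/
def segPts {n : ℕ} (S : Sym2 (Pt n)) : Set (Pt n) :=
  {p | ∃ a b, S = s(a, b) ∧ ∃ t : ℝ, 0 ≤ t ∧ t ≤ 1 ∧ p = a + t • (b - a)}

def Trace.pts {n : ℕ} (T : Trace n) : Set (Pt n) := ⋃ S ∈ T.segs, segPts S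

/-- A set of curves covers `X ⊆ ℝ^n`: each lattice segment containing a point of `X`
appears in one and only one of the curves. -/
def Covers {n : ℕ} (E : Set (Curve n)) (X : Set (Pt n)) : Prop :=
  ∀ S, IsSeg S → (segPts S ∩ X).Nonempty →
    (∃ c ∈ E, S ∈ c.segs) ∧ ∀ c ∈ E, ∀ d ∈ E, S ∈ c.segs → S ∈ d.segs → SameCurve c d

/-- A covering of `ℝ^n` by disjoint self-avoiding curves. -/
def IsCovering {n : ℕ} (E : Set (Curve n)) : Prop := DisjSA E ∧ Covers E Set.univ

/-- A single curve covers `X`. -/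
def CurveCovers {n : ℕ} (c : Curve n) (X : Set (Pt n)) : Prop :=
  ∀ S, IsSeg S → (segPts S ∩ X).Nonempty → S ∈ c.segs

/-- `b` is a curve contained in the curve `a`. -/
def SubCurve {n : ℕ} (b a : Curve n) : Prop :=
  b.segs ⊆ a.segs ∧ ∀ S T, b.conn S T → a.conn S T

/-- The relation `≺` at the level of traces. -/
def TPrec {n : ℕ} (T T' : Trace n) : Prop :=
  T.segs ⊆ T'.segs ∧ ∀ S S', T.conn S S' → T'.conn S S'

/-- `E ≺ F` : each segment of a curve of `E` is a segment of a curve of `F` and each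
connexion between two segments of a curve of `E` also exists in `F`. -/
def Prec {n : ℕ} (E F : Set (Curve n)) : Prop := TPrec (traceOf E) (traceOf F)

/-- Image of a trace under a map of `ℝ^n`. -/
def Trace.map {n : ℕ} (f : Pt n → Pt n) (T : Trace n) : Trace n :=
  ⟨Sym2.map f '' T.segs,
   fun S S' => ∃ A B, T.conn A B ∧ S = Sym2.map f A ∧ S' = Sym2.map f B⟩

/-- Translation of a trace by the vector `t`. -/
def Trace.transl {n : ℕ} (t : Pt n) (T : Trace n) : Trace n := T.map (fun p => p + t)

/-- Property (H) for the pair `(k, l)`. -/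
def SatH {n : ℕ} (A : Set (Curve n)) (k l : ℕ) : Prop :=
  0 < k ∧ 0 < l ∧ k ∣ l ∧ IsCovering A ∧
  (∀ c ∈ A, c.dom.Finite ∧ ∃ x i, latt x ∧ inLat k x ∧ c.IsEndpt x ∧
      c.IsEndpt (x + (k : ℝ) • uvec n i) ∧
      ∀ p, c.IsEndpt p → p = x ∨ p = x + (k : ℝ) • uvec n i) ∧
  (∀ (x : Pt n) (i : Fin n), latt x → inLat k x →
      (∃ c ∈ A, c.IsEndpt x ∧ c.IsEndpt (x + (k : ℝ) • uvec n i)) ∧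
      ∀ c ∈ A, ∀ d ∈ A, c.IsEndpt x → c.IsEndpt (x + (k : ℝ) • uvec n i) →
        d.IsEndpt x → d.IsEndpt (x + (k : ℝ) • uvec n i) → SameCurve c d) ∧
  (∀ t : Pt n, inLat l t → Trace.transl t (traceOf A) = traceOf A)

/-- The trace of the convolution product `A ∗ B`, where `A` satisfies (H) for `(k, l)`:
apply to `B` the homothety of center `0` and ratio `k`, then replace each resulting
segment by the curve of `A` having the same endpoints (connexions come from the curves
of `A`, together with the junctions of the end segments of consecutive `A`-curves). -/
def ConvTrace {n : ℕ} (k : ℕ) (A B : Set (Curve n)) : Trace n where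
  segs := {S | ∃ a b : Pt n, s(a, b) ∈ (traceOf B).segs ∧
    ∃ c ∈ A, c.IsEndpt ((k : ℝ) • a) ∧ c.IsEndpt ((k : ℝ) • b) ∧ S ∈ c.segs}
  conn := fun S S' =>
    (∃ a b : Pt n, s(a, b) ∈ (traceOf B).segs ∧
      ∃ c ∈ A, c.IsEndpt ((k : ℝ) • a) ∧ c.IsEndpt ((k : ℝ) • b) ∧ c.conn S S') ∨
    (∃ a b d : Pt n, (traceOf B).conn s(a, b) s(b, d) ∧
      ∃ c ∈ A, ∃ c' ∈ A, c.IsEndpt ((k : ℝ) • a) ∧ c.IsEndpt ((k : ℝ) • b) ∧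
        c'.IsEndpt ((k : ℝ) • b) ∧ c'.IsEndpt ((k : ℝ) • d) ∧
        ((c.endSegAt ((k : ℝ) • b) S ∧ c'.endSegAt ((k : ℝ) • b) S') ∨
         (c.endSegAt ((k : ℝ) • b) S' ∧ c'.endSegAt ((k : ℝ) • b) S)))

/-- The two-sided identity of the convolution product: the covering consisting of all
curves with one segment. -/
def unitTrace (n : ℕ) : Trace n := ⟨{S | IsSeg S}, fun _ _ => False⟩

/-- `P s` realizes the power `A^s` for the convolution product. -/
def PowersOf {n : ℕ} (A : Set (Curve n)) (k : ℕ) (P : ℕ → Set (Curve n)) : Prop :=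
  (∀ s, DisjSA (P s)) ∧ traceOf (P 0) = unitTrace n ∧
  ∀ s, traceOf (P (s + 1)) = ConvTrace k A (P s)

/-- The trace of `Â`, the inductive limit of the `A^s` for `≺`. -/
def hatTrace {n : ℕ} (P : ℕ → Set (Curve n)) : Trace n :=
  ⟨{S | ∃ s, S ∈ (traceOf (P s)).segs}, fun S T => ∃ s, (traceOf (P s)).conn S T⟩

/-- A pairing relation on `E = {e_1, -e_1, …, e_n, -e_n}`. -/
def IsPairing {n : ℕ} (R : Pt n → Pt n → Prop) : Prop :=
  (∀ u v, R u v → R v u) ∧ (∀ u v, R u v → IsDir u ∧ IsDir v) ∧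
  (∀ u, ¬ R u u) ∧ ∀ u, IsDir u → ∃! v, R u v

/-- The trace of `Â_R` : `Â` with the segments with endpoint `0` connected according
to `R`. -/
def hatRTrace {n : ℕ} (P : ℕ → Set (Curve n)) (R : Pt n → Pt n → Prop) : Trace n :=
  ⟨(hatTrace P).segs,
   fun S T => (hatTrace P).conn S T ∨
     ∃ u v, R u v ∧ S = s((0 : Pt n), u) ∧ T = s((0 : Pt n), v)⟩

/-- The cube `P_{x,h}`. -/
def cube {n : ℕ} (x : Pt n) (h : ℕ) : Set (Pt n) :=
  {p | ∀ i, x i - h ≤ p i ∧ p i ≤ x i + h}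

/-- Restriction of a trace to a region `X` of `ℝ^n`. -/
def Trace.restr {n : ℕ} (T : Trace n) (X : Set (Pt n)) : Trace n :=
  ⟨{S | S ∈ T.segs ∧ segPts S ⊆ X},
   fun S S' => T.conn S S' ∧ segPts S ⊆ X ∧ segPts S' ⊆ X⟩

/-- Condition (C). -/
def CondC {n : ℕ} (T : Trace n) : Prop :=
  ∀ (x : Pt n) (h : ℕ), latt x → 1 ≤ h →
    ∃ y : Pt n, latt y ∧ y ∉ cube x h ∧
      Trace.transl (y - x) (T.restr (cube x h)) = T.restr (cube y h)

/-- `(B(x,r) ∩ T, x) ≅ (B(y,r) ∩ T', y)` : the translation sending `x` to `y` maps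
the part of `T` in the closed ball `B(x,r)` onto the part of `T'` in `B(y,r)`,
preserving the connexions between segments. -/
def BallIso {n : ℕ} (T : Trace n) (x : Pt n) (T' : Trace n) (y : Pt n) (r : ℝ) : Prop :=
  (fun p => p + (y - x)) '' (T.pts ∩ Metric.closedBall x r) =
      T'.pts ∩ Metric.closedBall y r ∧
  (∀ S S', T.conn S S' → segPts S ⊆ Metric.closedBall x r →
      segPts S' ⊆ Metric.closedBall x r →
      T'.conn (Sym2.map (fun p => p + (y - x)) S) (Sym2.map (fun p => p + (y - x)) S')) ∧
  (∀ S S', T'.conn S S' → segPts S ⊆ Metric.closedBall y r →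
      segPts S' ⊆ Metric.closedBall y r →
      T.conn (Sym2.map (fun p => p + (x - y)) S) (Sym2.map (fun p => p + (x - y)) S'))

/-- The local isomorphism property. -/
def LocIsoProp {n : ℕ} (T : Trace n) : Prop :=
  ∀ (x : Pt n) (r : ℝ), 0 ≤ r →
    ∃ t : ℝ, 0 ≤ t ∧ ∀ y : Pt n, ∃ z ∈ Metric.closedBall y t, BallIso T x T z r

/-- Two traces are locally isomorphic. -/
def LocallyIso {n : ℕ} (T T' : Trace n) : Prop :=
  (∀ (x : Pt n) (r : ℝ), 0 ≤ r → ∃ y, BallIso T x T' y r) ∧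
  (∀ (y : Pt n) (r : ℝ), 0 ≤ r → ∃ x, BallIso T' y T x r)

/-- `Ω_{s,x}` : suppress the connexions between segments whose common endpoint lies in
`x + k^s ℤ^n`. -/
def OmegaTrace {n : ℕ} (k s : ℕ) (x : Pt n) (T : Trace n) : Trace n :=
  ⟨T.segs, fun S S' => T.conn S S' ∧ ¬ ∃ p, p ∈ S ∧ p ∈ S' ∧ inLat (k ^ s) (p - x)⟩

/-- `Σ_{s,x}(E)` : for each curve `D` of `E` passing through `x`, the curve(s) with
endpoint `x` contained in `D` having maximal length, this length being limited to
`8^s`. -/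
def SigmaSet {n : ℕ} (s : ℕ) (x : Pt n) (E : Set (Curve n)) : Set (Curve n) :=
  {b | ∃ D ∈ E, SubCurve b D ∧ b.IsEndpt x ∧ b.nsegs ≤ 8 ^ s ∧
    ∀ b' : Curve n, SubCurve b' D → b'.IsEndpt x → b'.nsegs ≤ 8 ^ s →
      SubCurve b b' → SameCurve b b'}

/-- A positive (orientation preserving) isometry of `ℝ^n`. -/
def PosIsom {n : ℕ} (f : Pt n → Pt n) : Prop :=
  ∃ (g : Pt n ≃ₗᵢ[ℝ] Pt n) (t : Pt n), (∀ x, f x = g x + t) ∧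
    0 < LinearMap.det (g.toLinearEquiv.toLinearMap)

/-- `E` consists of exactly `m` curves. -/
def HasExactly {n : ℕ} (E : Set (Curve n)) (m : ℕ) : Prop :=
  ∃ L : List (Curve n), L.length = m ∧ (∀ c ∈ L, c ∈ E) ∧
    L.Pairwise (fun c d => ¬ SameCurve c d) ∧ ∀ c ∈ E, ∃ d ∈ L, SameCurve c d

/-- `E` consists of at most `m` curves. -/
def AtMost {n : ℕ} (E : Set (Curve n)) (m : ℕ) : Prop :=
  ∃ L : List (Curve n), L.length ≤ m ∧ ∀ c ∈ E, ∃ d ∈ L, SameCurve c d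

/-- The set of points of a curve. -/
def curvePts {n : ℕ} (c : Curve n) : Set (Pt n) := ⋃ S ∈ c.segs, segPts S

-- ℝ³-specific part
def toPt3 (f : Fin 3 → ℝ) : Pt 3 := (WithLp.equiv 2 (Fin 3 → ℝ)).symm f

def p3 (a b c : ℤ) : Pt 3 := toPt3 ![(a : ℝ), (b : ℝ), (c : ℝ)]

/-- The vertices of the curve `C`. -/
def CList : List (Pt 3) :=
  [p3 0 0 0, p3 0 (-1) 0, p3 0 (-1) (-1), p3 0 0 (-1), p3 1 0 (-1),
   p3 1 (-1) (-1), p3 1 (-1) 0, p3 1 0 0, p3 2 0 0]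

/-- The block `ℬ₀` : six curves given by their lists of successive vertices. -/
def B0 : List (List (Pt 3)) :=
  [ CList,
    [p3 0 0 0, p3 0 0 1, p3 0 1 1, p3 0 1 0, p3 (-1) 1 0, p3 (-1) 1 1,
     p3 (-1) 0 1, p3 (-1) 0 0, p3 (-2) 0 0],
    [p3 0 0 0, p3 0 0 (-1), p3 (-1) 0 (-1), p3 (-1) 0 0, p3 (-1) 1 0,
     p3 (-1) 1 (-1), p3 0 1 (-1), p3 0 1 0, p3 0 2 0],
    [p3 0 0 0, p3 1 0 0, p3 1 0 1, p3 0 0 1, p3 0 (-1) 1, p3 1 (-1) 1,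
     p3 1 (-1) 0, p3 0 (-1) 0, p3 0 (-2) 0],
    [p3 0 0 0, p3 (-1) 0 0, p3 (-1) (-1) 0, p3 0 (-1) 0, p3 0 (-1) 1,
     p3 (-1) (-1) 1, p3 (-1) 0 1, p3 0 0 1, p3 0 0 2],
    [p3 0 0 0, p3 0 1 0, p3 1 1 0, p3 1 0 0, p3 1 0 (-1), p3 1 1 (-1),
     p3 0 1 (-1), p3 0 0 (-1), p3 0 0 (-2)] ]

def sigma3 : Pt 3 → Pt 3 := fun x => toPt3 ![x 0, -(x 1), -(x 2)]
def tau3 : Pt 3 → Pt 3 := fun x => toPt3 ![x 0, x 2, -(x 1)]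
def ups3 : Pt 3 → Pt 3 := fun x => toPt3 ![x 0, -(x 2), x 1]

/-- The four blocks `ℬ₀, ℬ₁, ℬ₂, ℬ₃`. -/
def blockLists : Fin 4 → List (List (Pt 3)) :=
  ![B0,
    B0.map (List.map fun p => p3 2 2 0 + sigma3 p),
    B0.map (List.map fun p => p3 2 0 2 + tau3 p),
    B0.map (List.map fun p => p3 0 2 2 + ups3 p)]

def listSegs (L : List (Pt 3)) : Set (Sym2 (Pt 3)) :=
  {S | ∃ j : ℕ, j + 1 < L.length ∧ S = s(L.getD j 0, L.getD (j + 1) 0)}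

def listConn (L : List (Pt 3)) (S T : Sym2 (Pt 3)) : Prop :=
  ∃ j : ℕ, j + 2 < L.length ∧
    ((S = s(L.getD j 0, L.getD (j + 1) 0) ∧ T = s(L.getD (j + 1) 0, L.getD (j + 2) 0)) ∨
     (T = s(L.getD j 0, L.getD (j + 1) 0) ∧ S = s(L.getD (j + 1) 0, L.getD (j + 2) 0)))

/-- The trace of the curve given by a list of successive vertices. -/
def listTrace (L : List (Pt 3)) : Trace 3 := ⟨listSegs L, listConn L⟩

/-- The trace of the covering `𝒞 = ⋃_{u ∈ ℤ³, 0 ≤ i ≤ 3} (4u + ℬ_i)`. -/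
def CTrace : Trace 3 where
  segs := {S | ∃ u : Pt 3, latt u ∧ ∃ (i : Fin 4), ∃ M ∈ blockLists i,
    S ∈ (Trace.transl ((4 : ℝ) • u) (listTrace M)).segs}
  conn := fun S T => ∃ u : Pt 3, latt u ∧ ∃ (i : Fin 4), ∃ M ∈ blockLists i,
    (Trace.transl ((4 : ℝ) • u) (listTrace M)).conn S T

open Classical in
/-- The permutation `θ` of `E` with `θ(e₁) = -e₂`, `θ(e₂) = -e₃`, `θ(e₃) = -e₁`
and `θ² = Id`. -/
def theta3 : Pt 3 → Pt 3 := fun u =>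
  if u = uvec 3 0 then -uvec 3 1
  else if u = -uvec 3 1 then uvec 3 0
  else if u = uvec 3 1 then -uvec 3 2
  else if u = -uvec 3 2 then uvec 3 1
  else if u = uvec 3 2 then -uvec 3 0
  else if u = -uvec 3 0 then uvec 3 2
  else u

/-- `R^θ`. -/
def Rtheta (R : Pt 3 → Pt 3 → Prop) : Pt 3 → Pt 3 → Prop :=
  fun u v => R (theta3 u) (theta3 v)

def Rx (P : ℕ → Set (Curve 3)) (x : Pt 3) : Pt 3 → Pt 3 → Prop :=
  fun u v => (hatTrace P).conn s(x, x + u) s(x, x + v)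

/-- Condition (P). -/
def SatP (P : ℕ → Set (Curve 3)) (R : Pt 3 → Pt 3 → Prop) : Prop :=
  ∃ x : Pt 3, (∀ i, x i = -2 ∨ x i = 0 ∨ x i = 2 ∨ x i = 4) ∧
    (¬ ∀ i, x i = 0 ∨ x i = 4) ∧ (Rx P x = R ∨ Rx P x = Rtheta R)

/-- The trace of `Ĉ_X`, the inductive limit of the sets `x_s + 𝒞^s`. -/
def hatXTrace (P : ℕ → Set (Curve 3)) (x : ℕ → Pt 3) : Trace 3 :=
  ⟨{S | ∃ s, 1 ≤ s ∧ S ∈ (Trace.transl (x s) (traceOf (P s))).segs},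
   fun S T => ∃ s, 1 ≤ s ∧ (Trace.transl (x s) (traceOf (P s))).conn S T⟩

/-- The curve `c` is equivalent to `C` (image of `C` by a positive isometry). -/
def EquivToC (c : Curve 3) : Prop :=
  ∃ f, PosIsom f ∧ curveTrace c = Trace.map f (listTrace CList)

/-- `x` is an endpoint of type `0` (resp. `1`) of the curve `c`, for `c`
equivalent to `C`. -/
def EndptType (c : Curve 3) (x : Pt 3) (ty : ℕ) : Prop :=
  ∃ f, PosIsom f ∧ curveTrace c = Trace.map f (listTrace CList) ∧
    x = f (if ty = 0 then p3 0 0 0 else p3 2 0 0)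

/-- Integer points of the lattice `ℤ³`. -/
abbrev Z3 := ℤ × ℤ × ℤ

/-- Residue classes of integer points modulo `4`. -/
abbrev Res := ZMod 4 × ZMod 4 × ZMod 4

/-- The residue class of an integer point modulo `4`. -/
def red (p : Z3) : Res := ((p.1 : ZMod 4), (p.2.1 : ZMod 4), (p.2.2 : ZMod 4))

/-- The six directions `e₁, -e₁, e₂, -e₂, e₃, -e₃`, in this order. -/
def dvec : Fin 6 → Z3 :=
  ![(1, 0, 0), (-1, 0, 0), (0, 1, 0), (0, -1, 0), (0, 0, 1), (0, 0, -1)]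

/-- The opposite direction. -/
def opp : Fin 6 → Fin 6 := ![1, 0, 3, 2, 5, 4]

/-- The permutation `θ` of the directions. -/
def thetaDir : Fin 6 → Fin 6 := ![3, 4, 5, 0, 1, 2]

/-- All the coordinates of the residue class are even. -/
def EvenRes (q : Res) : Prop :=
  (q.1 = 0 ∨ q.1 = 2) ∧ (q.2.1 = 0 ∨ q.2.1 = 2) ∧ (q.2.2 = 0 ∨ q.2.2 = 2)

instance : DecidablePred EvenRes := fun q => by unfold EvenRes; infer_instance

/-- The involutions of the directions which occur in `junction`. -/
def dirPerm : Fin 9 → Fin 6 → Fin 6 :=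
  ![![3, 4, 5, 0, 1, 2], ![0, 1, 2, 3, 4, 5], ![4, 2, 1, 5, 0, 3],
    ![5, 3, 4, 1, 2, 0], ![2, 5, 0, 4, 3, 1], ![5, 2, 1, 4, 3, 0],
    ![3, 5, 4, 0, 2, 1], ![4, 3, 5, 1, 0, 2], ![2, 4, 0, 5, 1, 3]]

/-- The indices in `dirPerm` of the local patterns of the covering `𝒞` at the points of
`(ℤ/4ℤ)³`. -/
def patternTable : Fin 4 → Fin 4 → Fin 4 → Fin 9 :=
  ![![![0, 0, 1, 0], ![0, 2, 3, 0], ![1, 3, 3, 3], ![0, 4, 3, 3]],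
    ![![0, 4, 2, 3], ![3, 5, 2, 3], ![4, 3, 3, 4], ![0, 4, 4, 6]],
    ![![1, 2, 2, 2], ![4, 4, 2, 3], ![4, 4, 1, 4], ![4, 2, 2, 0]],
    ![![0, 0, 2, 2], ![2, 2, 3, 7], ![4, 2, 3, 0], ![4, 8, 0, 0]]]

/-- At a point `x ∉ 2ℤ³`, `junction` gives the connexions of `𝒞`.  At a point `2 • b`, the curve
of `𝒞` joining `2 • b` to `2 • b + 2 • e` starts in the direction `junction e`. -/
def junction (q : Res) : Fin 6 → Fin 6 := dirPerm (patternTable q.1 q.2.1 q.2.2)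

/-- Displacement obtained by following the curve of `𝒞` through a point, in a given direction,
to its endpoint, for at most `n + 1` steps. -/
def walkDisp : ℕ → Res → Fin 6 → Z3
  | 0, _, d => dvec d
  | n + 1, q, d =>
    if EvenRes (q + red (dvec d)) then dvec d
    else dvec d + walkDisp n (q + red (dvec d)) (junction (q + red (dvec d)) (opp d))

theorem junction_ne (q : Res) (hq : ¬ EvenRes q) (d : Fin 6) : junction q d ≠ d := by
  revert q d; decide +kernel

theorem junction_junction (q : Res) (d : Fin 6) : junction q (junction q d) = d := by
  revert q d; decide +kernel

theorem walkDisp_step (q : Res) (d : Fin 6) (h : ¬ EvenRes (q + red (dvec d))) :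
    walkDisp 7 q d = dvec d +
      walkDisp 7 (q + red (dvec d)) (junction (q + red (dvec d)) (opp d)) := by
  revert q d; decide +kernel

theorem walkDisp_even (q : Res) (d : Fin 6) (h : EvenRes q) :
    walkDisp 7 q d = (2 : ℤ) • dvec (junction q d) := by
  revert q d; decide +kernel

theorem junction_zero : junction 0 = thetaDir := by decide +kernel

/-- The points near `0` whose connexions in `𝒞` distinguish `0` from the points outside `2ℤ³`. -/
def probes : List Z3 :=
  [(1, 1, 1), (1, -1, -1), (-1, 1, -1), (-1, -1, 1), (1, 0, 0), (0, 1, 0), (0, 0, 1),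
    (-1, 0, 0), (0, -1, 0), (0, 0, -1), (1, 1, 0), (1, 0, 1), (0, 1, 1)]

theorem exists_probe (q : Res) (hq : ¬ EvenRes q) :
    ∃ p ∈ probes, ¬ EvenRes (red p) ∧ ¬ EvenRes (q + red p) ∧
      ∃ e, junction (red p) e ≠ junction (q + red p) e := by
  revert q; decide +kernel

/-- The integer vertices of the six curves of `ℬ₀`. -/
def intB0 : List (List Z3) :=
  [[(0, 0, 0), (0, -1, 0), (0, -1, -1), (0, 0, -1), (1, 0, -1),
     (1, -1, -1), (1, -1, 0), (1, 0, 0), (2, 0, 0)],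
    [(0, 0, 0), (0, 0, 1), (0, 1, 1), (0, 1, 0), (-1, 1, 0), (-1, 1, 1),
     (-1, 0, 1), (-1, 0, 0), (-2, 0, 0)],
    [(0, 0, 0), (0, 0, -1), (-1, 0, -1), (-1, 0, 0), (-1, 1, 0),
     (-1, 1, -1), (0, 1, -1), (0, 1, 0), (0, 2, 0)],
    [(0, 0, 0), (1, 0, 0), (1, 0, 1), (0, 0, 1), (0, -1, 1), (1, -1, 1),
     (1, -1, 0), (0, -1, 0), (0, -2, 0)],
    [(0, 0, 0), (-1, 0, 0), (-1, -1, 0), (0, -1, 0), (0, -1, 1),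
     (-1, -1, 1), (-1, 0, 1), (0, 0, 1), (0, 0, 2)],
    [(0, 0, 0), (0, 1, 0), (1, 1, 0), (1, 0, 0), (1, 0, -1), (1, 1, -1),
     (0, 1, -1), (0, 0, -1), (0, 0, -2)]]

/-- The integer vertices of the curves of the blocks `ℬ₀, ℬ₁, ℬ₂, ℬ₃`. -/
def intBlocks : Fin 4 → List (List Z3) :=
  ![intB0,
    intB0.map (List.map fun p => (2 + p.1, 2 + -p.2.1, 0 + -p.2.2)),
    intB0.map (List.map fun p => (2 + p.1, 0 + p.2.2, 2 + -p.2.1)),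
    intB0.map (List.map fun p => (0 + p.1, 2 + -p.2.2, 2 + p.2.1))]

theorem length_intBlocks : ∀ i, ∀ L ∈ intBlocks i, L.length = 9 := by decide +kernel

theorem intBlocks_conn : ∀ i, ∀ L ∈ intBlocks i, ∀ j < 7,
    ¬ EvenRes (red (L.getD (j + 1) 0)) ∧ ∃ d, L.getD j 0 = L.getD (j + 1) 0 + dvec d ∧
      L.getD (j + 2) 0 = L.getD (j + 1) 0 + dvec (junction (red (L.getD (j + 1) 0)) d) := by
  decide +kernel

set_option synthInstance.maxSize 1000 in
set_option synthInstance.maxHeartbeats 200000 in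
theorem exists_intBlocks (q : Res) (hq : ¬ EvenRes q) (d : Fin 6) :
    ∃ i, ∃ L ∈ intBlocks i, ∃ j < 7, red (L.getD (j + 1) 0) = q ∧
      ((L.getD j 0 = L.getD (j + 1) 0 + dvec d ∧
        L.getD (j + 2) 0 = L.getD (j + 1) 0 + dvec (junction q d)) ∨
       (L.getD (j + 2) 0 = L.getD (j + 1) 0 + dvec d ∧
        L.getD j 0 = L.getD (j + 1) 0 + dvec (junction q d))) := by
  revert q d; decide +kernel

theorem red_add (p q : Z3) : red (p + q) = red p + red q := by
  simp [red]

theorem red_zero : red 0 = 0 := by simp [red]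

theorem red_add_four_zsmul (p q : Z3) : red (p + (4 : ℤ) • q) = red p := by
  have h : (4 : ZMod 4) = 0 := rfl
  simp [red, h]

theorem red_eq_iff {p q : Z3} : red p = red q ↔ ∃ u : Z3, p = (4 : ℤ) • u + q := by
  constructor
  · intro h
    simp only [red, Prod.mk.injEq, ZMod.intCast_eq_intCast_iff_dvd_sub] at h
    obtain ⟨⟨a, ha⟩, ⟨b, hb⟩, c, hc⟩ := h
    refine ⟨(-a, -b, -c), ?_⟩
    ext <;> simp at * <;> omega
  · rintro ⟨u, rfl⟩
    rw [add_comm, red_add_four_zsmul]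

theorem evenRes_red_iff {p : Z3} : EvenRes (red p) ↔ ∃ b : Z3, p = (2 : ℤ) • b := by
  have key : ∀ a : ℤ, ((a : ZMod 4) = 0 ∨ (a : ZMod 4) = 2) ↔ ∃ b, a = 2 * b := by
    intro a
    have h0 : (a : ZMod 4) = 0 ↔ (4 : ℤ) ∣ a := by
      simpa using ZMod.intCast_zmod_eq_zero_iff_dvd a 4
    have h2 : (a : ZMod 4) = 2 ↔ (4 : ℤ) ∣ 2 - a := by
      simpa using ZMod.intCast_eq_intCast_iff_dvd_sub a 2 4
    rw [h0, h2]
    constructor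
    · rintro (h | h)
      · exact ⟨a / 2, by omega⟩
      · exact ⟨a / 2, by omega⟩
    · rintro ⟨b, rfl⟩
      omega
  simp only [EvenRes, red, key]
  constructor
  · rintro ⟨⟨a, ha⟩, ⟨b, hb⟩, c, hc⟩
    exact ⟨(a, b, c), by ext <;> simp [*]⟩
  · rintro ⟨b, rfl⟩
    exact ⟨⟨b.1, by simp⟩, ⟨b.2.1, by simp⟩, b.2.2, by simp⟩

theorem dvec_opp (d : Fin 6) : dvec (opp d) = -dvec d := by
  revert d; decide

theorem dvec_injective : Function.Injective dvec := by decide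

theorem dvec_ne_zero (d : Fin 6) : dvec d ≠ 0 := by
  revert d; decide

/-- The embedding of the integer points into `ℝ³`. -/
def emb (p : Z3) : Pt 3 := p3 p.1 p.2.1 p.2.2

@[simp] theorem emb_apply_zero (p : Z3) : emb p 0 = p.1 := rfl
@[simp] theorem emb_apply_one (p : Z3) : emb p 1 = p.2.1 := rfl
@[simp] theorem emb_apply_two (p : Z3) : emb p 2 = p.2.2 := rfl

theorem pt3_ext {a b : Pt 3} (h0 : a 0 = b 0) (h1 : a 1 = b 1) (h2 : a 2 = b 2) : a = b := by
  ext i; fin_cases i <;> assumption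

theorem emb_injective : Function.Injective emb := by
  intro p q h
  have h0 := congrArg (fun a : Pt 3 => a 0) h
  have h1 := congrArg (fun a : Pt 3 => a 1) h
  have h2 := congrArg (fun a : Pt 3 => a 2) h
  simp at h0 h1 h2
  ext <;> assumption

theorem emb_inj {p q : Z3} : emb p = emb q ↔ p = q := emb_injective.eq_iff

theorem emb_zero : emb 0 = 0 := by
  apply pt3_ext <;> simp

theorem emb_add (p q : Z3) : emb (p + q) = emb p + emb q := by
  apply pt3_ext <;> simp

theorem emb_neg (p : Z3) : emb (-p) = -emb p := by
  apply pt3_ext <;> simp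

theorem emb_sub (p q : Z3) : emb (p - q) = emb p - emb q := by
  apply pt3_ext <;> simp

theorem emb_zsmul (n : ℤ) (p : Z3) : emb (n • p) = (n : ℝ) • emb p := by
  apply pt3_ext <;> simp

theorem latt_iff {p : Pt 3} : latt p ↔ ∃ q, p = emb q := by
  constructor
  · intro h
    obtain ⟨a, ha⟩ := h 0
    obtain ⟨b, hb⟩ := h 1
    obtain ⟨c, hc⟩ := h 2
    exact ⟨(a, b, c), pt3_ext ha hb hc⟩
  · rintro ⟨q, rfl⟩ i
    fin_cases i
    exacts [⟨_, rfl⟩, ⟨_, rfl⟩, ⟨_, rfl⟩]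

theorem emb_dvec_zero : emb (dvec 0) = uvec 3 0 := by
  apply pt3_ext <;> simp [dvec, uvec]

theorem emb_dvec_one : emb (dvec 1) = -uvec 3 0 := by
  apply pt3_ext <;> simp [dvec, uvec]

theorem emb_dvec_two : emb (dvec 2) = uvec 3 1 := by
  apply pt3_ext <;> simp [dvec, uvec]

theorem emb_dvec_three : emb (dvec 3) = -uvec 3 1 := by
  apply pt3_ext <;> simp [dvec, uvec]

theorem emb_dvec_four : emb (dvec 4) = uvec 3 2 := by
  apply pt3_ext <;> simp [dvec, uvec]

theorem emb_dvec_five : emb (dvec 5) = -uvec 3 2 := by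
  apply pt3_ext <;> simp [dvec, uvec]

theorem exists_uvec_eq_dvec (i : Fin 3) : ∃ d, uvec 3 i = emb (dvec d) := by
  fin_cases i
  exacts [⟨0, emb_dvec_zero.symm⟩, ⟨2, emb_dvec_two.symm⟩, ⟨4, emb_dvec_four.symm⟩]

theorem isDir_iff {u : Pt 3} : IsDir u ↔ ∃ d, u = emb (dvec d) := by
  constructor
  · rintro ⟨i, rfl | rfl⟩
    · exact exists_uvec_eq_dvec i
    · obtain ⟨d, hd⟩ := exists_uvec_eq_dvec i
      exact ⟨opp d, by rw [dvec_opp, emb_neg, hd]⟩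
  · rintro ⟨d, rfl⟩
    fin_cases d
    exacts [⟨0, .inl emb_dvec_zero⟩, ⟨0, .inr emb_dvec_one⟩, ⟨1, .inl emb_dvec_two⟩,
      ⟨1, .inr emb_dvec_three⟩, ⟨2, .inl emb_dvec_four⟩, ⟨2, .inr emb_dvec_five⟩]

theorem theta3_emb (d : Fin 6) : theta3 (emb (dvec d)) = emb (dvec (thetaDir d)) := by
  simp only [theta3, ← emb_dvec_zero, ← emb_dvec_two, ← emb_dvec_four, ← emb_neg, emb_inj,
    ← dvec_opp, dvec_injective.eq_iff]
  fin_cases d <;> simp [opp, thetaDir]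

theorem theta3_of_not_isDir {u : Pt 3} (h : ¬ IsDir u) : theta3 u = u := by
  rw [isDir_iff] at h
  push Not at h
  simp only [theta3, ← emb_dvec_zero, ← emb_dvec_two, ← emb_dvec_four, ← emb_neg, ← dvec_opp,
    h, if_false]

/-- The segment with endpoint `p` in the direction `d`. -/
def seg (p : Z3) (d : Fin 6) : Sym2 (Pt 3) := s(emb p, emb (p + dvec d))

theorem isSeg_seg (p : Z3) (d : Fin 6) : IsSeg (seg p d) := by
  have h : ∀ i (p : Z3), emb (dvec d) = uvec 3 i → IsSeg (seg p d) := fun i p h =>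
    ⟨emb p, i, latt_iff.2 ⟨_, rfl⟩, by rw [seg, emb_add, h]⟩
  have h' : ∀ i, emb (dvec d) = -uvec 3 i → IsSeg (seg p d) := fun i h =>
    ⟨emb (p + dvec d), i, latt_iff.2 ⟨_, rfl⟩, by
      rw [seg, Sym2.eq_swap, emb_add, h, neg_add_cancel_right]⟩
  fin_cases d
  exacts [h 0 p emb_dvec_zero, h' 0 emb_dvec_one, h 1 p emb_dvec_two, h' 1 emb_dvec_three,
    h 2 p emb_dvec_four, h' 2 emb_dvec_five]

theorem isSeg_iff {S : Sym2 (Pt 3)} : IsSeg S ↔ ∃ p d, S = seg p d := by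
  constructor
  · rintro ⟨x, i, hx, rfl⟩
    obtain ⟨p, rfl⟩ := latt_iff.1 hx
    obtain ⟨d, hd⟩ := exists_uvec_eq_dvec i
    exact ⟨p, d, by rw [seg, hd, emb_add]⟩
  · rintro ⟨p, d, rfl⟩
    exact isSeg_seg p d

/-- Two different segments with a common endpoint determine this endpoint. -/
theorem eq_of_mk_eq_seg {y a b : Pt 3} {p : Z3} {d e : Fin 6} (hde : d ≠ e)
    (h : s(a, y) = seg p d) (h' : s(y, b) = seg p e) :
    y = emb p ∧ a = emb (p + dvec d) ∧ b = emb (p + dvec e) := by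
  rw [seg, Sym2.eq_iff] at h h'
  rcases h with ⟨h1, h2⟩ | ⟨h1, h2⟩
  · rcases h' with ⟨h3, h4⟩ | ⟨h3, h4⟩
    · rw [h2, emb_inj] at h3
      simp [dvec_ne_zero] at h3
    · rw [h2, emb_inj, add_right_inj] at h3
      exact absurd (dvec_injective h3) hde
  · rcases h' with ⟨h3, h4⟩ | ⟨h3, h4⟩
    · exact ⟨h2, h1, h4⟩
    · rw [h2, emb_inj] at h3
      simp [dvec_ne_zero] at h3

/-- The set of connexions at the integer points given by a relation between directions. -/
def Linked (h : Z3 → Fin 6 → Fin 6 → Prop) (S T : Sym2 (Pt 3)) : Prop :=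
  ∃ p d e, h p d e ∧ S = seg p d ∧ T = seg p e

theorem linked_mk_iff {h : Z3 → Fin 6 → Fin 6 → Prop} (hh : ∀ p d, ¬ h p d d) {a y b : Pt 3} :
    Linked h s(a, y) s(y, b) ↔ ∃ p d e, h p d e ∧ y = emb p ∧ a = emb (p + dvec d) ∧
      b = emb (p + dvec e) := by
  constructor
  · rintro ⟨p, d, e, hp, h1, h2⟩
    exact ⟨p, d, e, hp, eq_of_mk_eq_seg (fun hde => hh p e (hde ▸ hp)) h1 h2⟩
  · rintro ⟨p, d, e, hp, rfl, rfl, rfl⟩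
    exact ⟨p, d, e, hp, Sym2.eq_swap, rfl⟩

theorem linked_seg_iff {h : Z3 → Fin 6 → Fin 6 → Prop} (hh : ∀ p d, ¬ h p d d) {p : Z3}
    {d e : Fin 6} : Linked h (seg p d) (seg p e) ↔ h p d e := by
  constructor
  · intro H
    rw [seg, Sym2.eq_swap] at H
    obtain ⟨q, d', e', hq, h1, h2, h3⟩ := (linked_mk_iff hh).1 H
    rw [emb_inj] at h1
    subst h1
    rw [emb_inj, add_right_inj, dvec_injective.eq_iff] at h2 h3
    rwa [h2, h3]
  · exact fun H => ⟨p, d, e, H, rfl, rfl⟩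

theorem p3_add_sigma3 (a b c : ℤ) (p : Z3) :
    p3 a b c + sigma3 (emb p) = emb (a + p.1, b + -p.2.1, c + -p.2.2) := by
  apply pt3_ext <;> simp [sigma3, toPt3, p3]

theorem p3_add_tau3 (a b c : ℤ) (p : Z3) :
    p3 a b c + tau3 (emb p) = emb (a + p.1, b + p.2.2, c + -p.2.1) := by
  apply pt3_ext <;> simp [tau3, toPt3, p3]

theorem p3_add_ups3 (a b c : ℤ) (p : Z3) :
    p3 a b c + ups3 (emb p) = emb (a + p.1, b + -p.2.2, c + p.2.1) := by
  apply pt3_ext <;> simp [ups3, toPt3, p3]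

theorem B0_eq : B0 = intB0.map (List.map emb) := by
  simp [B0, CList, intB0, emb]

theorem blockLists_eq (i : Fin 4) : blockLists i = (intBlocks i).map (List.map emb) := by
  fin_cases i
  · exact B0_eq
  · simp [blockLists, intBlocks, B0_eq, Function.comp_def, p3_add_sigma3]
  · simp [blockLists, intBlocks, B0_eq, Function.comp_def, p3_add_tau3]
  · simp [blockLists, intBlocks, B0_eq, Function.comp_def, p3_add_ups3]

/-- The connexions of the covering `𝒞`, as a relation between directions. -/
def baseLink (p : Z3) (d e : Fin 6) : Prop := ¬ EvenRes (red p) ∧ junction (red p) d = e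

theorem baseLink_irrefl (p : Z3) (d : Fin 6) : ¬ baseLink p d d := fun h =>
  junction_ne _ h.1 _ h.2

theorem baseLink_symm {p : Z3} {d e : Fin 6} (h : baseLink p d e) : baseLink p e d :=
  ⟨h.1, by rw [← h.2, junction_junction]⟩

theorem linked_baseLink_symm {S T : Sym2 (Pt 3)} (h : Linked baseLink S T) :
    Linked baseLink T S := by
  obtain ⟨p, d, e, h, rfl, rfl⟩ := h
  exact ⟨p, e, d, baseLink_symm h, rfl, rfl⟩

theorem CTrace_conn_iff {S T : Sym2 (Pt 3)} : CTrace.conn S T ↔ Linked baseLink S T := by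
  have getD_map : ∀ (L : List Z3) j, (L.map emb).getD j 0 = emb (L.getD j 0) := fun L j => by
    rw [← emb_zero, List.getD_map]
  have map_seg : ∀ (u p q : Z3), Sym2.map (fun x => x + (4 : ℝ) • emb u) s(emb p, emb q) =
      s(emb ((4 : ℤ) • u + p), emb ((4 : ℤ) • u + q)) := fun u p q => by
    rw [Sym2.map_mk, emb_add, emb_add, emb_zsmul, add_comm (emb p), add_comm (emb q)]
    norm_num
  have red4 : ∀ u p : Z3, red ((4 : ℤ) • u + p) = red p := fun u p => by
    rw [add_comm, red_add_four_zsmul]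
  constructor
  · rintro ⟨u, hu, i, M, hM, A, B, ⟨j, hj, hAB⟩, hS, hT⟩
    obtain ⟨u, rfl⟩ := latt_iff.1 hu
    rw [blockLists_eq, List.mem_map] at hM
    obtain ⟨L, hL, rfl⟩ := hM
    rw [List.length_map, length_intBlocks i L hL] at hj
    obtain ⟨hev, d, h1, h2⟩ := intBlocks_conn i L hL j (by omega)
    simp only [getD_map, h1, h2] at hAB
    generalize L.getD (j + 1) 0 = p at *
    have key : Linked baseLink (seg ((4 : ℤ) • u + p) d)
        (seg ((4 : ℤ) • u + p) (junction (red p) d)) :=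
      ⟨_, d, _, ⟨by rwa [red4], by rw [red4]⟩, rfl, rfl⟩
    have e1 : s(emb ((4 : ℤ) • u + (p + dvec d)), emb ((4 : ℤ) • u + p)) =
        seg ((4 : ℤ) • u + p) d := by rw [seg, Sym2.eq_swap, add_assoc]
    have e2 : s(emb ((4 : ℤ) • u + p), emb ((4 : ℤ) • u + (p + dvec (junction (red p) d)))) =
        seg ((4 : ℤ) • u + p) (junction (red p) d) := by rw [seg, add_assoc]
    rw [hS, hT]
    rcases hAB with ⟨rfl, rfl⟩ | ⟨rfl, rfl⟩
    · rw [map_seg, map_seg, e1, e2]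
      exact key
    · rw [map_seg, map_seg, e1, e2]
      exact linked_baseLink_symm key
  · rintro ⟨p, d, _, ⟨hev, rfl⟩, rfl, rfl⟩
    obtain ⟨i, L, hL, j, hj, hred, h⟩ := exists_intBlocks _ hev d
    obtain ⟨u, hu⟩ := red_eq_iff.1 hred.symm
    refine ⟨emb u, latt_iff.2 ⟨u, rfl⟩, i, L.map emb, ?_, ?_⟩
    · rw [blockLists_eq]
      exact List.mem_map_of_mem hL
    generalize hq : L.getD (j + 1) 0 = q at *
    have e1 : ∀ d, seg p d = Sym2.map (fun x => x + (4 : ℝ) • emb u)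
        s(emb q, emb (q + dvec d)) := fun d => by
      rw [map_seg, seg, hu, add_assoc]
    refine ⟨_, _, ⟨j, ?_, ?_⟩, e1 d, e1 _⟩
    · rw [List.length_map, length_intBlocks i L hL]
      omega
    · simp only [getD_map, hq]
      rcases h with ⟨h1, h2⟩ | ⟨h1, h2⟩
      · left
        rw [h1, h2]
        exact ⟨Sym2.eq_swap, rfl⟩
      · right
        rw [h1, h2]
        exact ⟨Sym2.eq_swap, rfl⟩

theorem Curve.IsEndpt.exists_endSegAt {n : ℕ} {c : Curve n} {p : Pt n} (h : c.IsEndpt p) :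
    ∃ S, c.endSegAt p S := by
  obtain ⟨i, hi, rfl, h⟩ := h
  have key : i - 1 ∈ c.dom ∨ i + 1 ∈ c.dom := by
    obtain ⟨j, hj, hj'⟩ := c.nontriv
    rcases lt_trichotomy i j with hij | rfl | hij
    · exact .inr (c.ordConn.out hi hj ⟨by omega, by omega⟩)
    · exact .inr hj'
    · exact .inl (c.ordConn.out hj hi ⟨by omega, by omega⟩)
  rcases h with h | h
  · exact ⟨_, i, hi, rfl, .inl ⟨h, key.resolve_left h, rfl⟩⟩
  · exact ⟨_, i, hi, rfl, .inr ⟨h, key.resolve_right h, rfl⟩⟩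

/-- A finite curve, followed from one endpoint to the other one. -/
theorem Curve.endSegAt.exists_path {n : ℕ} {c : Curve n} (hc : c.dom.Finite) {p : Pt n}
    {S : Sym2 (Pt n)} (h : c.endSegAt p S) :
    ∃ (m : ℕ) (w : ℕ → Pt n), w 0 = p ∧ S = s(w 0, w 1) ∧ (∀ k ≤ m + 1, latt (w k)) ∧
      (∀ k < m, c.conn s(w k, w (k + 1)) s(w (k + 1), w (k + 2))) ∧ c.IsEndpt (w (m + 1)) := by
  have mk_congr : ∀ {a b a' b' : ℤ}, a = a' → b = b' → s(c.v a, c.v b) = s(c.v a', c.v b') := by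
    rintro a b _ _ rfl rfl
    rfl
  have mk_swap : ∀ {a b a' b' : ℤ}, a = b' → b = a' → s(c.v a, c.v b) = s(c.v a', c.v b') := by
    rintro a b _ _ rfl rfl
    exact Sym2.eq_swap
  obtain ⟨i, hi, rfl, ⟨h1, h2, rfl⟩ | ⟨h1, h2, rfl⟩⟩ := h
  · obtain ⟨j, hj, hmax⟩ := exists_max_image c.dom id hc ⟨i, hi⟩
    simp only [id] at hmax
    have hij := hmax _ h2
    have hmem : ∀ k : ℤ, i ≤ k → k ≤ j → k ∈ c.dom := fun k h h' => c.ordConn.out hi hj ⟨h, h'⟩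
    refine ⟨(j - i - 1).toNat, fun k => c.v (i + k), by simp, by simp, ?_, ?_, ?_⟩
    · exact fun k hk => c.lattice _ (hmem _ (by omega) (by omega))
    · intro k hk
      refine ⟨i + k + 1, hmem _ (by omega) (by omega), hmem _ (by omega) (by omega),
        .inl ⟨mk_congr ?_ ?_, mk_congr ?_ ?_⟩⟩ <;> push_cast <;> ring
    · refine ⟨j, hj, ?_, .inr fun h => ?_⟩
      · refine congrArg c.v ?_
        omega
      · have := hmax _ h
        omega
  · obtain ⟨j, hj, hmin⟩ := exists_min_image c.dom id hc ⟨i, hi⟩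
    simp only [id] at hmin
    have hij := hmin _ h2
    have hmem : ∀ k : ℤ, j ≤ k → k ≤ i → k ∈ c.dom := fun k h h' => c.ordConn.out hj hi ⟨h, h'⟩
    refine ⟨(i - j - 1).toNat, fun k => c.v (i - k), by simp, by simp [Sym2.eq_swap], ?_, ?_, ?_⟩
    · exact fun k hk => c.lattice _ (hmem _ (by omega) (by omega))
    · intro k hk
      refine ⟨i - k - 1, hmem _ (by omega) (by omega), hmem _ (by omega) (by omega),
        .inr ⟨mk_swap ?_ ?_, mk_swap ?_ ?_⟩⟩ <;> push_cast <;> ring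
    · refine ⟨j, hj, ?_, .inl fun h => ?_⟩
      · refine congrArg c.v ?_
        omega
      · have := hmin _ h
        omega

theorem inLat_two_emb {p : Z3} (h : inLat 2 (emb p)) : EvenRes (red p) := by
  rw [evenRes_red_iff]
  obtain ⟨a, ha⟩ := h 0
  obtain ⟨b, hb⟩ := h 1
  obtain ⟨c, hc⟩ := h 2
  refine ⟨(a, b, c), ?_⟩
  simp only [emb_apply_zero, emb_apply_one, emb_apply_two] at ha hb hc
  norm_cast at ha hb hc
  ext <;> simpa using by assumption

/-- A path which follows the connexions of `𝒞` up to a point of `2ℤ³` is described by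
`walkDisp`. -/
theorem eq_walkDisp_of_path (m : ℕ) : ∀ (w : ℕ → Pt 3) (p : Z3) (d : Fin 6), w 0 = emb p →
    w 1 = emb (p + dvec d) →
    (∀ k < m, Linked baseLink s(w k, w (k + 1)) s(w (k + 1), w (k + 2))) →
    inLat 2 (w (m + 1)) → w (m + 1) = emb (p + walkDisp 7 (red p) d) := by
  induction m with
  | zero =>
    intro w p d h0 h1 _ hlat
    rw [zero_add, h1] at hlat ⊢
    have := inLat_two_emb hlat
    rw [red_add] at this
    rw [walkDisp, if_pos this]
  | succ m ih =>
    intro w p d h0 h1 hconn hlat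
    obtain ⟨q, d', e', ⟨hev, rfl⟩, h3, h4, h5⟩ :=
      (linked_mk_iff baseLink_irrefl).1 (hconn 0 (by omega))
    simp only [zero_add] at h3 h4 h5
    rw [h1, emb_inj] at h3
    subst h3
    rw [h0, emb_inj, add_assoc, left_eq_add, add_eq_zero_iff_neg_eq, ← dvec_opp] at h4
    rw [← dvec_injective h4] at h5
    have := ih (fun k => w (k + 1)) _ _ h1 h5
      (fun k hk => hconn (k + 1) (by omega)) hlat
    rw [red_add] at hev
    rw [this, walkDisp_step _ _ hev, red_add, add_assoc]

section

variable {C3 : Set (Curve 3)}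

theorem conn_of_mem (hC3 : traceOf C3 = CTrace) {c : Curve 3} (hc : c ∈ C3) {S T : Sym2 (Pt 3)}
    (h : c.conn S T) : Linked baseLink S T := by
  rw [← CTrace_conn_iff, ← hC3]
  exact ⟨c, hc, h⟩

/-- The end segments of the curves of `𝒞`. -/
theorem endSegAt_iff (hC3 : traceOf C3 = CTrace) (hH : SatH C3 2 4) {c : Curve 3} (hc : c ∈ C3)
    {b : Z3} {e : Fin 6} (h1 : c.IsEndpt (emb ((2 : ℤ) • b)))
    (h2 : c.IsEndpt (emb ((2 : ℤ) • (b + dvec e)))) {S : Sym2 (Pt 3)} :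
    c.endSegAt (emb ((2 : ℤ) • b)) S ↔
      S = seg ((2 : ℤ) • b) (junction (red ((2 : ℤ) • b)) e) := by
  obtain ⟨-, -, -, -, hfin, -, -⟩ := hH
  obtain ⟨hdom, x, i, hx, hx2, hx3, hx4, hend⟩ := hfin c hc
  have hev : EvenRes (red ((2 : ℤ) • b)) := evenRes_red_iff.2 ⟨b, rfl⟩
  have hsub : ∀ p, c.IsEndpt p → inLat 2 p := by
    intro p hp
    rcases hend p hp with rfl | rfl
    · exact hx2
    · intro k
      obtain ⟨m, hm⟩ := hx2 k
      refine ⟨m + if k = i then 1 else 0, ?_⟩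
      by_cases hk : k = i
      · subst hk
        simp [uvec, hm, mul_add]
      · simp [uvec, hm, hk]
  have hb : emb ((2 : ℤ) • b) ≠ emb ((2 : ℤ) • (b + dvec e)) := by
    rw [Ne, emb_inj, smul_add, left_eq_add, smul_eq_zero]
    simp [dvec_ne_zero]
  have hor : ∀ p, c.IsEndpt p → p = emb ((2 : ℤ) • b) ∨ p = emb ((2 : ℤ) • (b + dvec e)) := by
    intro p hp
    rcases hend p hp with rfl | rfl <;> rcases hend _ h1 with h1 | h1 <;>
      rcases hend _ h2 with h2 | h2 <;> simp_all
  have key : ∀ S, c.endSegAt (emb ((2 : ℤ) • b)) S →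
      S = seg ((2 : ℤ) • b) (junction (red ((2 : ℤ) • b)) e) := by
    intro S hS
    obtain ⟨m, w, h0, rfl, hlatt, hconn, hw⟩ := hS.exists_path hdom
    have hseg : ∃ d, w 1 = emb ((2 : ℤ) • b + dvec d) := by
      obtain ⟨i, hi, hpi, ⟨-, hi', hS⟩ | ⟨-, hi', hS⟩⟩ := hS
      · rw [h0, hpi, Sym2.congr_right] at hS
        obtain ⟨j, hj⟩ := c.step i hi hi'
        obtain ⟨d, hd⟩ := isDir_iff.1 (show IsDir (w 1 - w 0) from ⟨j, by
          rw [hS, h0, hpi]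
          rcases hj with hj | hj <;> simp [hj]⟩)
        exact ⟨d, by rw [emb_add, ← hd, h0]; abel⟩
      · rw [h0, hpi, Sym2.eq_swap, Sym2.congr_left] at hS
        obtain ⟨j, hj⟩ := c.step (i - 1) hi' (by simpa)
        rw [sub_add_cancel] at hj
        obtain ⟨d, hd⟩ := isDir_iff.1 (show IsDir (w 1 - w 0) from ⟨j, by
          rw [hS, h0, hpi]
          rcases hj with hj | hj <;> simp [hj]⟩)
        exact ⟨d, by rw [emb_add, ← hd, h0]; abel⟩
    obtain ⟨d, hd⟩ := hseg
    have hwalk := eq_walkDisp_of_path m w _ d h0 hd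
      (fun k hk => conn_of_mem hC3 hc (hconn k hk)) (hsub _ hw)
    rw [walkDisp_even _ _ hev, ← smul_add] at hwalk
    have h2inj : Function.Injective fun p : Z3 => (2 : ℤ) • p :=
      smul_right_injective _ two_ne_zero
    rcases hor _ hw with h | h
    · rw [h, emb_inj] at hwalk
      have := h2inj hwalk
      simp [dvec_ne_zero] at this
    · rw [h, emb_inj] at hwalk
      have := dvec_injective (add_left_cancel (h2inj hwalk))
      rw [h0, hd, this, junction_junction, seg]
  refine ⟨key S, ?_⟩
  rintro rfl
  obtain ⟨S, hS⟩ := h1.exists_endSegAt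
  rwa [← key S hS]

/-- The connexions of `𝒞^s`, as a relation between directions. -/
def powLink : ℕ → Z3 → Fin 6 → Fin 6 → Prop
  | 0, _, _, _ => False
  | s + 1, x, d, e => baseLink x d e ∨
    ∃ b, x = (2 : ℤ) • b ∧ powLink s b (junction (red x) d) (junction (red x) e)

theorem powLink_irrefl (s : ℕ) (p : Z3) (d : Fin 6) : ¬ powLink s p d d := by
  induction s generalizing p d with
  | zero => exact id
  | succ s ih =>
    rintro (h | ⟨b, rfl, h⟩)
    · exact baseLink_irrefl _ _ h
    · exact ih _ _ h

theorem powLink_symm {s : ℕ} {p : Z3} {d e : Fin 6} (h : powLink s p d e) : powLink s p e d := by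
  induction s generalizing p d e with
  | zero => exact h
  | succ s ih =>
    rcases h with h | ⟨b, rfl, h⟩
    · exact .inl (baseLink_symm h)
    · exact .inr ⟨b, rfl, ih h⟩

theorem Curve.isSeg_of_mem_segs {c : Curve 3} {S : Sym2 (Pt 3)} (h : S ∈ c.segs) : IsSeg S := by
  obtain ⟨i, hi, hi', rfl⟩ := h
  obtain ⟨j, hj | hj⟩ := c.step i hi hi'
  · exact ⟨c.v i, j, c.lattice i hi, by rw [hj]⟩
  · exact ⟨c.v (i + 1), j, c.lattice _ hi', by rw [hj, Sym2.eq_swap, sub_add_cancel]⟩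

theorem exists_eq_two_zsmul {x : Pt 3} (h : inLat 2 x) : ∃ b : Z3, x = emb ((2 : ℤ) • b) := by
  have hx : latt x := fun i => by
    obtain ⟨c, hc⟩ := h i
    exact ⟨2 * c, by rw [hc]; push_cast; ring⟩
  obtain ⟨p, rfl⟩ := latt_iff.1 hx
  obtain ⟨b, rfl⟩ := evenRes_red_iff.1 (inLat_two_emb h)
  exact ⟨b, rfl⟩

theorem inLat_two_zsmul (b : Z3) : inLat 2 (emb ((2 : ℤ) • b)) := by
  intro i
  rw [emb_zsmul]
  obtain ⟨m, hm⟩ := latt_iff.2 ⟨b, rfl⟩ i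
  exact ⟨m, by simp [hm]⟩

theorem two_smul_emb (b : Z3) : ((2 : ℕ) : ℝ) • emb b = emb ((2 : ℤ) • b) := by
  rw [emb_zsmul]
  norm_num

/-- The curve of `𝒞` which replaces a segment. -/
theorem exists_curve (hH : SatH C3 2 4) (b : Z3) (e : Fin 6) :
    ∃ c ∈ C3, c.IsEndpt (emb ((2 : ℤ) • b)) ∧ c.IsEndpt (emb ((2 : ℤ) • (b + dvec e))) := by
  obtain ⟨-, -, -, -, -, hex, -⟩ := hH
  obtain ⟨x, i, hx, h⟩ := isSeg_seg b e
  have hx2 : inLat 2 (((2 : ℕ) : ℝ) • x) := by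
    obtain ⟨p, rfl⟩ := latt_iff.1 hx
    rw [two_smul_emb]
    exact inLat_two_zsmul p
  obtain ⟨⟨c, hc, h1, h2⟩, -⟩ := hex (((2 : ℕ) : ℝ) • x) i
    (by obtain ⟨p, rfl⟩ := latt_iff.1 hx
        rw [two_smul_emb]
        exact latt_iff.2 ⟨_, rfl⟩) hx2
  rw [← smul_add] at h2
  refine ⟨c, hc, ?_⟩
  rw [← two_smul_emb, ← two_smul_emb]
  rcases Sym2.eq_iff.1 h with ⟨h3, h4⟩ | ⟨h3, h4⟩
  · rw [h3, h4]
    exact ⟨h1, h2⟩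
  · rw [h3, h4]
    exact ⟨h2, h1⟩

/-- Each curve of `𝒞` replaces some segment. -/
theorem exists_ends (hH : SatH C3 2 4) {c : Curve 3} (hc : c ∈ C3) :
    ∃ a b, IsSeg s(a, b) ∧ c.IsEndpt (((2 : ℕ) : ℝ) • a) ∧ c.IsEndpt (((2 : ℕ) : ℝ) • b) := by
  obtain ⟨-, -, -, -, hfin, -, -⟩ := hH
  obtain ⟨-, x, i, hx, hx2, hx3, hx4, -⟩ := hfin c hc
  obtain ⟨b, rfl⟩ := exists_eq_two_zsmul hx2
  rw [← two_smul_emb] at hx3 hx4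
  rw [← smul_add] at hx4
  exact ⟨_, _, ⟨_, i, latt_iff.2 ⟨b, rfl⟩, rfl⟩, hx3, hx4⟩

theorem exists_mem_segs (hH : SatH C3 2 4) {S : Sym2 (Pt 3)} (hS : IsSeg S) :
    ∃ c ∈ C3, S ∈ c.segs := by
  obtain ⟨-, -, -, ⟨-, hcov⟩, -, -, -⟩ := hH
  refine (hcov S hS ?_).1
  obtain ⟨x, i, -, rfl⟩ := hS
  exact ⟨x, ⟨x, _, rfl, 0, by simp⟩, trivial⟩

/-- The segments and the connexions of the coverings `𝒞^s`. -/
theorem traceOf_pow (hC3 : traceOf C3 = CTrace) (hH : SatH C3 2 4) {P : ℕ → Set (Curve 3)}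
    (hP : PowersOf C3 2 P) (s : ℕ) : (traceOf (P s)).segs = {S | IsSeg S} ∧
      ∀ S T, (traceOf (P s)).conn S T ↔ Linked (powLink s) S T := by
  obtain ⟨-, h0, hsucc⟩ := hP
  induction s with
  | zero =>
    rw [h0]
    exact ⟨rfl, fun S T => ⟨False.elim, fun ⟨_, _, _, h, _⟩ => h⟩⟩
  | succ s ih =>
    obtain ⟨ihs, ihc⟩ := ih
    rw [hsucc]
    constructor
    · ext S
      constructor
      · rintro ⟨a, b, -, c, -, -, -, h⟩
        exact c.isSeg_of_mem_segs h
      · intro hS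
        obtain ⟨c, hc, hSc⟩ := exists_mem_segs hH hS
        obtain ⟨a, b, hab, ha, hb⟩ := exists_ends hH hc
        exact ⟨a, b, ihs ▸ hab, c, hc, ha, hb, hSc⟩
    · intro S T
      constructor
      · rintro (⟨a, b, -, c, hc, -, -, h⟩ | ⟨a, b, d, h, c, hc, c', hc', h1, h2, h3, h4, h5⟩)
        · obtain ⟨p, d, e, h', rfl, rfl⟩ := conn_of_mem hC3 hc h
          exact ⟨p, d, e, .inl h', rfl, rfl⟩
        · rw [ihc, linked_mk_iff (powLink_irrefl s)] at h
          obtain ⟨p, d, e, h, rfl, rfl, rfl⟩ := h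
          rw [two_smul_emb] at h1 h2 h3 h4 h5
          rw [endSegAt_iff hC3 hH hc h2 h1, endSegAt_iff hC3 hH hc' h3 h4,
            endSegAt_iff hC3 hH hc h2 h1, endSegAt_iff hC3 hH hc' h3 h4] at h5
          rcases h5 with ⟨rfl, rfl⟩ | ⟨rfl, rfl⟩
          · exact ⟨_, _, _, .inr ⟨p, rfl, by simpa only [junction_junction]⟩, rfl, rfl⟩
          · exact ⟨_, _, _, .inr ⟨p, rfl, by
              simpa only [junction_junction] using powLink_symm h⟩, rfl, rfl⟩
      · rintro ⟨p, d, e, h | ⟨b, rfl, h⟩, rfl, rfl⟩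
        · left
          have : (traceOf C3).conn (seg p d) (seg p e) := by
            rw [hC3, CTrace_conn_iff]
            exact ⟨p, d, e, h, rfl, rfl⟩
          obtain ⟨c, hc, hconn⟩ := this
          obtain ⟨a, b, hab, ha, hb⟩ := exists_ends hH hc
          exact ⟨a, b, ihs ▸ hab, c, hc, ha, hb, hconn⟩
        · right
          obtain ⟨c, hc, h1, h2⟩ := exists_curve hH b (junction (red ((2 : ℤ) • b)) d)
          obtain ⟨c', hc', h3, h4⟩ := exists_curve hH b (junction (red ((2 : ℤ) • b)) e)
          refine ⟨_, _, _, (ihc _ _).2 ((linked_mk_iff (powLink_irrefl s)).2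
            ⟨b, _, _, h, rfl, rfl, rfl⟩), c, hc, c', hc', ?_⟩
          simp only [two_smul_emb]
          refine ⟨h2, h1, h3, h4, .inl ?_⟩
          rw [endSegAt_iff hC3 hH hc h1 h2, endSegAt_iff hC3 hH hc' h3 h4, junction_junction,
            junction_junction]
          exact ⟨rfl, rfl⟩

/-- The connexions of `Ĉ`, as a relation between directions. -/
def hatLink (p : Z3) (d e : Fin 6) : Prop := ∃ s, powLink s p d e

theorem hatLink_irrefl (p : Z3) (d : Fin 6) : ¬ hatLink p d d := fun ⟨s, h⟩ =>
  powLink_irrefl s p d h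

theorem hatTrace_segs (hC3 : traceOf C3 = CTrace) (hH : SatH C3 2 4) {P : ℕ → Set (Curve 3)}
    (hP : PowersOf C3 2 P) : (hatTrace P).segs = {S | IsSeg S} := by
  ext S
  simp [hatTrace, (traceOf_pow hC3 hH hP _).1]

theorem hatTrace_conn_iff (hC3 : traceOf C3 = CTrace) (hH : SatH C3 2 4)
    {P : ℕ → Set (Curve 3)} (hP : PowersOf C3 2 P) {S T : Sym2 (Pt 3)} :
    (hatTrace P).conn S T ↔ Linked hatLink S T := by
  simp only [hatTrace, (traceOf_pow hC3 hH hP _).2]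
  constructor
  · rintro ⟨s, p, d, e, h, hS, hT⟩
    exact ⟨p, d, e, ⟨s, h⟩, hS, hT⟩
  · rintro ⟨p, d, e, ⟨s, h⟩, hS, hT⟩
    exact ⟨s, p, d, e, h, hS, hT⟩

theorem hatLink_of_not_even {p : Z3} (hp : ¬ EvenRes (red p)) {d e : Fin 6} :
    hatLink p d e ↔ junction (red p) d = e := by
  constructor
  · rintro ⟨_ | s, h⟩
    · exact h.elim
    · rcases h with h | ⟨b, rfl, -⟩
      · exact h.2
      · exact absurd (evenRes_red_iff.2 ⟨b, rfl⟩) hp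
  · exact fun h => ⟨1, .inl ⟨hp, h⟩⟩

theorem hatLink_two_zsmul (b : Z3) (d e : Fin 6) : hatLink ((2 : ℤ) • b) d e ↔
    hatLink b (junction (red ((2 : ℤ) • b)) d) (junction (red ((2 : ℤ) • b)) e) := by
  constructor
  · rintro ⟨_ | s, h⟩
    · exact h.elim
    · rcases h with h | ⟨b', hb', h⟩
      · exact absurd (evenRes_red_iff.2 ⟨b, rfl⟩) h.1
      · rw [← smul_right_injective Z3 (two_ne_zero (α := ℤ)) hb'] at h
        exact ⟨s, h⟩
  · rintro ⟨s, h⟩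
    exact ⟨s + 1, .inr ⟨b, rfl, h⟩⟩

theorem not_hatLink_zero (d e : Fin 6) : ¬ hatLink 0 d e := by
  rintro ⟨s, h⟩
  induction s generalizing d e with
  | zero => exact h
  | succ s ih =>
    rcases h with h | ⟨b, hb, h⟩
    · refine h.1 (evenRes_red_iff.2 ⟨0, ?_⟩)
      simp
    · rw [eq_comm, smul_eq_zero_iff_right two_ne_zero] at hb
      subst hb
      exact ih _ _ h

theorem hatLink_four_zsmul (b : Z3) (d e : Fin 6) :
    hatLink ((2 : ℤ) • (2 : ℤ) • b) d e ↔
      hatLink ((2 : ℤ) • b) (thetaDir d) (thetaDir e) := by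
  have h : red ((2 : ℤ) • (2 : ℤ) • b) = 0 := by
    rw [smul_smul, ← zero_add ((2 * 2 : ℤ) • b)]
    exact (red_add_four_zsmul 0 b).trans red_zero
  rw [hatLink_two_zsmul, h, junction_zero]

theorem thetaDir_thetaDir (d : Fin 6) : thetaDir (thetaDir d) = d := by
  revert d; decide

theorem hatLink_periodic {y : Z3} (hy : ¬ EvenRes (red y)) (m : ℕ) (w : Z3) (d e : Fin 6) :
    hatLink ((2 : ℤ) ^ m • y + (2 : ℤ) ^ (m + 2) • w) d e ↔ hatLink ((2 : ℤ) ^ m • y) d e := by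
  induction m generalizing d e with
  | zero =>
    have h : red ((2 : ℤ) ^ 0 • y + (2 : ℤ) ^ (0 + 2) • w) = red y := by
      rw [pow_zero, one_smul]
      exact red_add_four_zsmul y w
    rw [hatLink_of_not_even (by rwa [h]), h, pow_zero, one_smul, hatLink_of_not_even hy]
  | succ m ih =>
    have h1 : (2 : ℤ) ^ (m + 1) • y = (2 : ℤ) • (2 : ℤ) ^ m • y := by
      rw [smul_smul, ← pow_succ']
    have h2 : (2 : ℤ) ^ (m + 1 + 2) • w = (2 : ℤ) • (2 : ℤ) ^ (m + 2) • w := by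
      rw [smul_smul, ← pow_succ']
    have h3 : red ((2 : ℤ) • ((2 : ℤ) ^ m • y + (2 : ℤ) ^ (m + 2) • w)) =
        red ((2 : ℤ) • (2 : ℤ) ^ m • y) := by
      rw [smul_add, show (2 : ℤ) • (2 : ℤ) ^ (m + 2) • w = (4 : ℤ) • (2 : ℤ) ^ (m + 1) • w by
        rw [smul_smul, smul_smul]
        congr 1
        ring, red_add_four_zsmul]
    rw [h1, h2, ← smul_add, hatLink_two_zsmul, h3, ih, ← hatLink_two_zsmul]

/-- The decomposition of a nonzero integer point. -/
theorem exists_eq_pow_zsmul (s : ℕ) {p : Z3} (hp : p ≠ 0) (h1 : |p.1| < 2 ^ s)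
    (h2 : |p.2.1| < 2 ^ s) (h3 : |p.2.2| < 2 ^ s) :
    ∃ m < s, ∃ y : Z3, ¬ EvenRes (red y) ∧ p = (2 : ℤ) ^ m • y := by
  induction s generalizing p with
  | zero =>
    simp only [pow_zero, Int.abs_lt_one_iff] at h1 h2 h3
    exact absurd (Prod.ext h1 (Prod.ext h2 h3)) hp
  | succ s ih =>
    by_cases hev : EvenRes (red p)
    · obtain ⟨b, rfl⟩ := evenRes_red_iff.1 hev
      have key : ∀ a : ℤ, |2 * a| < 2 ^ (s + 1) → |a| < 2 ^ s := fun a h => by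
        rw [abs_mul, abs_two, pow_succ'] at h
        omega
      obtain ⟨m, hm, y, hy, rfl⟩ := ih (p := b) (by rintro rfl; simp at hp) (key _ h1) (key _ h2)
        (key _ h3)
      exact ⟨m + 1, by omega, y, hy, by rw [smul_smul, pow_succ']⟩
    · exact ⟨0, by omega, p, hev, by simp⟩

theorem hatLink_pow_succ_succ (m : ℕ) (y : Z3) (d e : Fin 6) :
    hatLink ((2 : ℤ) ^ (m + 2) • y) d e ↔
      hatLink ((2 : ℤ) ^ (m + 1) • y) (thetaDir d) (thetaDir e) := by
  have h := hatLink_four_zsmul ((2 : ℤ) ^ m • y) d e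
  simpa only [smul_smul, ← pow_succ'] using h

theorem hatLink_pow_odd (k : ℕ) (y : Z3) (d e : Fin 6) :
    hatLink ((2 : ℤ) ^ (2 * k + 1) • y) d e ↔ hatLink ((2 : ℤ) • y) d e := by
  induction k generalizing d e with
  | zero => simp
  | succ k ih =>
    rw [show 2 * (k + 1) + 1 = 2 * k + 1 + 2 by ring, hatLink_pow_succ_succ,
      hatLink_pow_succ_succ, thetaDir_thetaDir, thetaDir_thetaDir, ih]

theorem exists_box_repr (y : Z3) : ∃ w : Z3,
    ((y + (4 : ℤ) • w).1 ∈ Icc (-1) 2) ∧ ((y + (4 : ℤ) • w).2.1 ∈ Icc (-1) 2) ∧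
      ((y + (4 : ℤ) • w).2.2 ∈ Icc (-1) 2) := by
  have key : ∀ a : ℤ, a + 4 * (-((a + 1) / 4)) ∈ Icc (-1) 2 := fun a => by
    constructor <;> omega
  exact ⟨(_, _, _), key _, key _, key _⟩

/-- The connexions of `Ĉ` at the nonzero points of `2ℤ³`. -/
theorem exists_hatLink_eq {x : Z3} (hx : x ≠ 0) (hev : EvenRes (red x)) :
    ∃ y : Z3, (y.1 ∈ Icc (-1) 2 ∧ y.2.1 ∈ Icc (-1) 2 ∧ y.2.2 ∈ Icc (-1) 2) ∧
      ¬ EvenRes (red y) ∧ ((∀ d e, hatLink ((2 : ℤ) • y) d e ↔ hatLink x d e) ∨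
        ∀ d e, hatLink ((2 : ℤ) • y) d e ↔ hatLink x (thetaDir d) (thetaDir e)) := by
  have hlt : ∀ n : ℤ, 0 ≤ n → n < 2 ^ n.toNat := fun n hn => by
    have := n.toNat.lt_two_pow_self
    zify at this
    rwa [Int.toNat_of_nonneg hn] at this
  have h := hlt (|x.1| + |x.2.1| + |x.2.2|) (by positivity)
  have h1 := abs_nonneg x.1
  have h2 := abs_nonneg x.2.1
  have h3 := abs_nonneg x.2.2
  obtain ⟨m, -, y, hy, rfl⟩ := exists_eq_pow_zsmul _ hx (by linarith) (by linarith) (by linarith)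
  clear h h1 h2 h3 hx
  obtain _ | m := m
  · simp [hy] at hev
  clear hev
  induction m with
  | zero =>
    obtain ⟨w, hw⟩ := exists_box_repr y
    refine ⟨_, hw, by rwa [red_add_four_zsmul], .inl fun d e => ?_⟩
    have := hatLink_periodic hy 1 w d e
    rw [← this, smul_add, smul_smul, pow_one]
    rfl
  | succ m ih =>
    obtain ⟨z, hz, hz', h⟩ := ih
    refine ⟨z, hz, hz', ?_⟩
    simp only [hatLink_pow_succ_succ, thetaDir_thetaDir]
    exact h.symm

/-- The relation between directions associated to a relation on `E`. -/
def dirRel (R : Pt 3 → Pt 3 → Prop) (d e : Fin 6) : Prop := R (emb (dvec d)) (emb (dvec e))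

/-- A relation which only holds between elements of `E` is determined by `dirRel`. -/
theorem eq_iff_dirRel {R R' : Pt 3 → Pt 3 → Prop} (h : ∀ u v, R u v → IsDir u ∧ IsDir v)
    (h' : ∀ u v, R' u v → IsDir u ∧ IsDir v) :
    R = R' ↔ ∀ d e, dirRel R d e ↔ dirRel R' d e := by
  constructor
  · rintro rfl d e
    rfl
  · intro H
    ext u v
    constructor
    · intro huv
      obtain ⟨hu, hv⟩ := h u v huv
      obtain ⟨d, rfl⟩ := isDir_iff.1 hu
      obtain ⟨e, rfl⟩ := isDir_iff.1 hv
      exact (H d e).1 huv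
    · intro huv
      obtain ⟨hu, hv⟩ := h' u v huv
      obtain ⟨d, rfl⟩ := isDir_iff.1 hu
      obtain ⟨e, rfl⟩ := isDir_iff.1 hv
      exact (H d e).2 huv

theorem Rtheta_isDir {R : Pt 3 → Pt 3 → Prop} (h : ∀ u v, R u v → IsDir u ∧ IsDir v)
    {u v : Pt 3} (huv : Rtheta R u v) : IsDir u ∧ IsDir v := by
  have key : ∀ u, IsDir (theta3 u) → IsDir u := fun u hu => by
    by_contra hu'
    exact hu' (theta3_of_not_isDir hu' ▸ hu)
  obtain ⟨h1, h2⟩ := h _ _ huv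
  exact ⟨key u h1, key v h2⟩

theorem dirRel_Rtheta (R : Pt 3 → Pt 3 → Prop) (d e : Fin 6) :
    dirRel (Rtheta R) d e ↔ dirRel R (thetaDir d) (thetaDir e) := by
  rw [dirRel, Rtheta, theta3_emb, theta3_emb, dirRel]

variable {P : ℕ → Set (Curve 3)}

theorem Rx_isDir (hC3 : traceOf C3 = CTrace) (hH : SatH C3 2 4) (hP : PowersOf C3 2 P) (x : Z3)
    {u v : Pt 3} (h : Rx P (emb x) u v) : IsDir u ∧ IsDir v := by
  rw [Rx, hatTrace_conn_iff hC3 hH hP, Sym2.eq_swap, linked_mk_iff hatLink_irrefl] at h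
  obtain ⟨p, d, e, -, hp, hu, hv⟩ := h
  rw [emb_add, ← hp, add_right_inj] at hu hv
  exact ⟨isDir_iff.2 ⟨d, hu⟩, isDir_iff.2 ⟨e, hv⟩⟩

theorem dirRel_Rx (hC3 : traceOf C3 = CTrace) (hH : SatH C3 2 4) (hP : PowersOf C3 2 P) (x : Z3)
    (d e : Fin 6) : dirRel (Rx P (emb x)) d e ↔ hatLink x d e := by
  rw [dirRel, Rx, hatTrace_conn_iff hC3 hH hP, ← emb_add, ← emb_add]
  exact linked_seg_iff hatLink_irrefl

theorem satP_iff (hC3 : traceOf C3 = CTrace) (hH : SatH C3 2 4) (hP : PowersOf C3 2 P)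
    {R : Pt 3 → Pt 3 → Prop} (hR : IsPairing R) :
    SatP P R ↔ ∃ y : Z3, (y.1 ∈ Icc (-1) 2 ∧ y.2.1 ∈ Icc (-1) 2 ∧ y.2.2 ∈ Icc (-1) 2) ∧
      ¬ EvenRes (red y) ∧ ((∀ d e, hatLink ((2 : ℤ) • y) d e ↔ dirRel R d e) ∨
        ∀ d e, hatLink ((2 : ℤ) • y) d e ↔ dirRel R (thetaDir d) (thetaDir e)) := by
  have hrel : ∀ y : Z3, (Rx P (emb ((2 : ℤ) • y)) = R ∨ Rx P (emb ((2 : ℤ) • y)) = Rtheta R) ↔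
      ((∀ d e, hatLink ((2 : ℤ) • y) d e ↔ dirRel R d e) ∨
        ∀ d e, hatLink ((2 : ℤ) • y) d e ↔ dirRel R (thetaDir d) (thetaDir e)) := fun y => by
    rw [eq_iff_dirRel (fun _ _ => Rx_isDir hC3 hH hP _) hR.2.1,
      eq_iff_dirRel (fun _ _ => Rx_isDir hC3 hH hP _) (fun _ _ => Rtheta_isDir hR.2.1)]
    simp only [dirRel_Rx hC3 hH hP, dirRel_Rtheta]
  have hbox : ∀ a : ℤ, (((2 * a : ℤ) : ℝ) = -2 ∨ ((2 * a : ℤ) : ℝ) = 0 ∨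
      ((2 * a : ℤ) : ℝ) = 2 ∨ ((2 * a : ℤ) : ℝ) = 4) ↔ a ∈ Icc (-1) 2 := fun a => by
    norm_cast
    rw [mem_Icc]
    omega
  have heven : ∀ y : Z3, y.1 ∈ Icc (-1) 2 → y.2.1 ∈ Icc (-1) 2 → y.2.2 ∈ Icc (-1) 2 →
      ((∀ i, emb ((2 : ℤ) • y) i = 0 ∨ emb ((2 : ℤ) • y) i = 4) ↔ EvenRes (red y)) := by
    rintro ⟨a, b, c⟩ ha hb hc
    have key : ∀ a ∈ Icc (-1 : ℤ) 2, (((2 * a : ℤ) : ℝ) = 0 ∨ ((2 * a : ℤ) : ℝ) = 4 ↔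
        (a : ZMod 4) = 0 ∨ (a : ZMod 4) = 2) := fun a ⟨h1, h2⟩ => by
      norm_cast
      interval_cases a <;> decide
    rw [Fin.forall_fin_succ, Fin.forall_fin_two]
    exact and_congr (key a ha) (and_congr (key b hb) (key c hc))
  constructor
  · rintro ⟨x, hx, hx', h⟩
    obtain ⟨y, rfl⟩ : ∃ y : Z3, x = emb ((2 : ℤ) • y) := by
      apply exists_eq_two_zsmul
      intro i
      rcases hx i with h | h | h | h
      exacts [⟨-1, by simp [h]⟩, ⟨0, by simp [h]⟩, ⟨1, by simp [h]⟩, ⟨2, by norm_num [h]⟩]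
    have h0 := (hbox y.1).1 (hx 0)
    have h1 := (hbox y.2.1).1 (hx 1)
    have h2 := (hbox y.2.2).1 (hx 2)
    exact ⟨y, ⟨h0, h1, h2⟩, by rwa [← heven y h0 h1 h2], (hrel y).1 h⟩
  · rintro ⟨y, ⟨h0, h1, h2⟩, hy, h⟩
    refine ⟨emb ((2 : ℤ) • y), ?_, by rwa [heven y h0 h1 h2], (hrel y).2 h⟩
    rw [Fin.forall_fin_succ, Fin.forall_fin_two]
    exact ⟨(hbox y.1).2 h0, (hbox y.2.1).2 h1, (hbox y.2.2).2 h2⟩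

/-- The connexions of `Ĉ_R`, as a relation between directions. -/
def fullLink (R : Pt 3 → Pt 3 → Prop) (p : Z3) (d e : Fin 6) : Prop :=
  hatLink p d e ∨ p = 0 ∧ dirRel R d e

theorem fullLink_zero {R : Pt 3 → Pt 3 → Prop} {d e : Fin 6} :
    fullLink R 0 d e ↔ dirRel R d e := by
  simp [fullLink, not_hatLink_zero]

theorem fullLink_of_ne_zero {R : Pt 3 → Pt 3 → Prop} {p : Z3} (hp : p ≠ 0) {d e : Fin 6} :
    fullLink R p d e ↔ hatLink p d e := by
  simp [fullLink, hp]

theorem fullLink_irrefl {R : Pt 3 → Pt 3 → Prop} (hR : IsPairing R) (p : Z3) (d : Fin 6) :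
    ¬ fullLink R p d d := by
  rintro (h | ⟨-, h⟩)
  · exact hatLink_irrefl p d h
  · exact hR.2.2.1 _ h

theorem hatRTrace_conn_iff (hC3 : traceOf C3 = CTrace) (hH : SatH C3 2 4) (hP : PowersOf C3 2 P)
    {R : Pt 3 → Pt 3 → Prop} (hR : IsPairing R) {S T : Sym2 (Pt 3)} :
    (hatRTrace P R).conn S T ↔ Linked (fullLink R) S T := by
  have hseg : ∀ d, seg 0 d = s((0 : Pt 3), emb (dvec d)) := fun d => by
    rw [seg, emb_zero, zero_add]
  constructor
  · rintro (h | ⟨u, v, h, rfl, rfl⟩)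
    · obtain ⟨p, d, e, h, hS, hT⟩ := (hatTrace_conn_iff hC3 hH hP).1 h
      exact ⟨p, d, e, .inl h, hS, hT⟩
    · obtain ⟨hu, hv⟩ := hR.2.1 u v h
      obtain ⟨d, rfl⟩ := isDir_iff.1 hu
      obtain ⟨e, rfl⟩ := isDir_iff.1 hv
      exact ⟨0, d, e, .inr ⟨rfl, h⟩, (hseg d).symm, (hseg e).symm⟩
  · rintro ⟨p, d, e, h | ⟨rfl, h⟩, rfl, rfl⟩
    · exact .inl ((hatTrace_conn_iff hC3 hH hP).2 ⟨p, d, e, h, rfl, rfl⟩)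
    · exact .inr ⟨_, _, h, hseg d, hseg e⟩

theorem map_add_emb_seg (p w : Z3) (d : Fin 6) :
    Sym2.map (fun x => x + emb w) (seg p d) = seg (p + w) d := by
  rw [seg, Sym2.map_mk, ← emb_add, ← emb_add, seg, add_right_comm]

theorem mem_segPts_seg (p : Z3) (d : Fin 6) : emb p ∈ segPts (seg p d) :=
  ⟨_, _, rfl, 0, le_rfl, zero_le_one, by simp⟩

theorem add_emb_mem_pts {T : Trace 3} (hT : T.segs = {S | IsSeg S}) {x : Pt 3} (hx : x ∈ T.pts)
    (w : Z3) : x + emb w ∈ T.pts := by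
  simp only [Trace.pts, hT, mem_iUnion₂] at hx ⊢
  obtain ⟨S, hS, a, b, rfl, t, h0, h1, rfl⟩ := hx
  obtain ⟨p, d, h⟩ := isSeg_iff.1 hS
  refine ⟨seg (p + w) d, isSeg_seg _ _, a + emb w, b + emb w, ?_, t, h0, h1, ?_⟩
  · rw [← map_add_emb_seg, ← h, Sym2.map_mk]
  · rw [add_sub_add_right_eq_sub, add_right_comm]

/-- A sufficient condition for a translation by an integer vector to induce an isomorphism
between balls. -/
theorem ballIso_add_emb {T : Trace 3} (hT : T.segs = {S | IsSeg S})
    {h : Z3 → Fin 6 → Fin 6 → Prop} (hconn : ∀ S S', T.conn S S' ↔ Linked h S S') (x : Pt 3)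
    (r : ℝ) (w : Z3)
    (hw : ∀ p d e, emb p ∈ Metric.closedBall x r → (h (p + w) d e ↔ h p d e)) :
    BallIso T x T (x + emb w) r := by
  rw [BallIso, add_sub_cancel_left, sub_add_cancel_left, ← emb_neg]
  refine ⟨?_, ?_, ?_⟩
  · ext y
    constructor
    · rintro ⟨y, ⟨hy, hy'⟩, rfl⟩
      refine ⟨add_emb_mem_pts hT hy w, ?_⟩
      simpa using hy'
    · rintro ⟨hy, hy'⟩
      refine ⟨y + emb (-w), ⟨add_emb_mem_pts hT hy _, ?_⟩, by simp [emb_neg]⟩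
      rw [mem_closedBall_iff_norm] at hy' ⊢
      rwa [emb_neg, show y + -emb w - x = y - (x + emb w) by abel]
  · intro S S' hSS hS hS'
    obtain ⟨p, d, e, hp, rfl, rfl⟩ := (hconn S S').1 hSS
    exact (hconn _ _).2 ⟨p + w, d, e, (hw p d e (hS (mem_segPts_seg p d))).2 hp,
      map_add_emb_seg _ _ _, map_add_emb_seg _ _ _⟩
  · intro S S' hSS hS hS'
    obtain ⟨p, d, e, hp, rfl, rfl⟩ := (hconn S S').1 hSS
    refine (hconn _ _).2 ⟨p + -w, d, e, (hw (p + -w) d e ?_).1 (by rwa [neg_add_cancel_right]),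
      map_add_emb_seg _ _ _, map_add_emb_seg _ _ _⟩
    have := hS (mem_segPts_seg p d)
    rw [mem_closedBall_iff_norm] at this ⊢
    rwa [emb_add, emb_neg, show emb p + -emb w - x = emb p - (x + emb w) by abel]

theorem norm_le_sum_abs (a : Pt 3) : ‖a‖ ≤ |a 0| + |a 1| + |a 2| := by
  rw [EuclideanSpace.norm_eq, Fin.sum_univ_three]
  apply Real.sqrt_le_iff.2
  simp only [Real.norm_eq_abs]
  have h0 := abs_nonneg (a 0)
  have h1 := abs_nonneg (a 1)
  have h2 := abs_nonneg (a 2)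
  exact ⟨by positivity, by nlinarith [mul_nonneg h0 h1, mul_nonneg h0 h2, mul_nonneg h1 h2]⟩

theorem abs_apply_le_norm (a : Pt 3) (i : Fin 3) : |a i| ≤ ‖a‖ := PiLp.norm_apply_le a i

theorem segPts_seg_subset {p : Z3} {d : Fin 6} {x : Pt 3} {r : ℝ}
    (h1 : emb p ∈ Metric.closedBall x r) (h2 : emb (p + dvec d) ∈ Metric.closedBall x r) :
    segPts (seg p d) ⊆ Metric.closedBall x r := by
  rintro q ⟨a, b, hab, t, h0, ht, rfl⟩
  have hc := convex_closedBall x r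
  rcases Sym2.eq_iff.1 hab with ⟨rfl, rfl⟩ | ⟨rfl, rfl⟩
  · exact hc.add_smul_sub_mem h1 h2 ⟨h0, ht⟩
  · exact hc.add_smul_sub_mem h2 h1 ⟨h0, ht⟩

theorem exists_dirRel {R : Pt 3 → Pt 3 → Prop} (hR : IsPairing R) : ∃ d e, dirRel R d e := by
  obtain ⟨v, hv, -⟩ := hR.2.2.2 _ (isDir_iff.2 ⟨0, rfl⟩)
  obtain ⟨e, rfl⟩ := isDir_iff.1 (hR.2.1 _ _ hv).2
  exact ⟨0, e, hv⟩

end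

theorem emb_mem_closedBall {p w : Z3} {r : ℤ} (h : |p.1 - w.1| + |p.2.1 - w.2.1| +
    |p.2.2 - w.2.2| ≤ r) : emb p ∈ Metric.closedBall (emb w) (r : ℝ) := by
  rw [mem_closedBall_iff_norm, ← emb_sub]
  refine (norm_le_sum_abs _).trans ?_
  simp only [emb_apply_zero, emb_apply_one, emb_apply_two, Prod.fst_sub, Prod.snd_sub]
  exact_mod_cast h

theorem segPts_seg_subset_closedBall {p w : Z3} {r : ℤ} (h : |p.1 - w.1| + |p.2.1 - w.2.1| +
    |p.2.2 - w.2.2| ≤ r) (d : Fin 6) :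
    segPts (seg p d) ⊆ Metric.closedBall (emb w) ((r + 1 : ℤ) : ℝ) := by
  have hd : |(dvec d).1| + |(dvec d).2.1| + |(dvec d).2.2| = 1 := by revert d; decide
  refine segPts_seg_subset (emb_mem_closedBall (by omega)) (emb_mem_closedBall ?_)
  simp only [Prod.fst_add, Prod.snd_add, add_sub_right_comm _ _ (_ : ℤ)]
  have h1 := abs_add_le (p.1 - w.1) (dvec d).1
  have h2 := abs_add_le (p.2.1 - w.2.1) (dvec d).2.1
  have h3 := abs_add_le (p.2.2 - w.2.2) (dvec d).2.2
  linarith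

/-- Under the local isomorphism property, the connexions at `0` reappear at some nonzero point
of `2ℤ³`. -/
theorem exists_hatLink_of_locIsoProp {C3 : Set (Curve 3)} {P : ℕ → Set (Curve 3)}
    (hC3 : traceOf C3 = CTrace) (hH : SatH C3 2 4) (hP : PowersOf C3 2 P)
    {R : Pt 3 → Pt 3 → Prop} (hR : IsPairing R) (h : LocIsoProp (hatRTrace P R)) :
    ∃ w : Z3, w ≠ 0 ∧ EvenRes (red w) ∧ ∀ d e, hatLink w d e ↔ dirRel R d e := by
  have hconn := fun S T => hatRTrace_conn_iff hC3 hH hP hR (S := S) (T := T)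
  obtain ⟨t, ht, h⟩ := h (emb 0) ((3 + 1 : ℤ) : ℝ) (by norm_num)
  obtain ⟨z, hz, -, h2, h3⟩ := h (emb (⌈t⌉ + 1, 0, 0))
  simp only [hconn] at h2 h3
  obtain ⟨w, rfl⟩ : ∃ w, z = emb w := by
    obtain ⟨d, e, hde⟩ := exists_dirRel hR
    have hlink := h2 _ _ ⟨0, d, e, fullLink_zero.2 hde, rfl, rfl⟩
      (segPts_seg_subset_closedBall (by simp) _) (segPts_seg_subset_closedBall (by simp) _)
    rw [seg, Sym2.map_mk, seg, Sym2.map_mk, Sym2.eq_swap,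
      linked_mk_iff (fullLink_irrefl hR)] at hlink
    obtain ⟨p, -, -, -, hp, -⟩ := hlink
    exact ⟨p, by rw [← hp]; abel⟩
  have hw : w ≠ 0 := by
    rintro rfl
    rw [mem_closedBall_iff_norm, ← emb_sub] at hz
    have h1 := (abs_apply_le_norm _ 0).trans hz
    have h4 := (le_abs_self _).trans (abs_neg (emb (0 - (⌈t⌉ + 1, 0, 0)) 0) ▸ h1)
    simp only [emb_apply_zero, Prod.fst_sub, Prod.fst_zero] at h4
    push_cast at h4
    linarith [Int.le_ceil t]
  rw [← emb_sub, sub_zero] at h2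
  rw [← emb_sub, zero_sub] at h3
  have h2' : ∀ p d e, |p.1| + |p.2.1| + |p.2.2| ≤ 3 → fullLink R p d e →
      fullLink R (p + w) d e := fun p d e hp hpl => by
    have := h2 _ _ ⟨p, d, e, hpl, rfl, rfl⟩ (segPts_seg_subset_closedBall (by simpa) _)
      (segPts_seg_subset_closedBall (by simpa) _)
    rwa [map_add_emb_seg, map_add_emb_seg, linked_seg_iff (fullLink_irrefl hR)] at this
  have h3' : ∀ d e, fullLink R w d e → fullLink R 0 d e := fun d e hpl => by
    have := h3 _ _ ⟨w, d, e, hpl, rfl, rfl⟩ (segPts_seg_subset_closedBall (by simp) _)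
      (segPts_seg_subset_closedBall (by simp) _)
    rwa [map_add_emb_seg, map_add_emb_seg, linked_seg_iff (fullLink_irrefl hR),
      add_neg_cancel] at this
  refine ⟨w, hw, ?_, fun d e => ?_⟩
  · by_contra hev
    obtain ⟨p, hp, hp1, hp2, e, he⟩ := exists_probe _ hev
    have hsmall : ∀ p ∈ probes, |p.1| + |p.2.1| + |p.2.2| ≤ 3 := by decide
    have hne : ∀ q : Z3, ¬ EvenRes (red q) → q ≠ 0 := by
      rintro _ hq rfl
      exact hq (by decide)
    rw [add_comm, ← red_add] at hp2 he
    have := h2' p e _ (hsmall p hp)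
      ((fullLink_of_ne_zero (hne p hp1)).2 ((hatLink_of_not_even hp1).2 rfl))
    rw [fullLink_of_ne_zero (hne _ hp2), hatLink_of_not_even hp2] at this
    exact he this.symm
  · rw [← fullLink_of_ne_zero hw, ← fullLink_zero]
    exact ⟨h3' d e, fun h => by simpa using h2' 0 d e (by simp) h⟩

theorem locIsoProp_of_forall_hatLink {C3 : Set (Curve 3)} {P : ℕ → Set (Curve 3)}
    (hC3 : traceOf C3 = CTrace) (hH : SatH C3 2 4) (hP : PowersOf C3 2 P)
    {R : Pt 3 → Pt 3 → Prop} (hR : IsPairing R) {y : Z3} (hy : ¬ EvenRes (red y))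
    (h : ∀ s, ∃ m, s < m ∧ ∀ d e, hatLink ((2 : ℤ) ^ m • y) d e ↔ dirRel R d e) :
    LocIsoProp (hatRTrace P R) := by
  intro x r hr
  obtain ⟨s, hs⟩ := pow_unbounded_of_one_lt (‖x‖ + r) one_lt_two
  obtain ⟨m, hm, hlink⟩ := h s
  refine ⟨3 * 2 ^ (m + 2), by positivity, fun u => ?_⟩
  have hfloor : ∀ a : ℝ, |2 ^ (m + 2) * (⌊a / 2 ^ (m + 2)⌋ : ℝ) - a| ≤ 2 ^ (m + 2) := fun a => by
    have hpos : (0 : ℝ) < 2 ^ (m + 2) := by positivity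
    have h1 := (le_div_iff₀ hpos).1 (Int.floor_le (a / 2 ^ (m + 2)))
    have h2 := (div_lt_iff₀ hpos).1 (Int.lt_floor_add_one (a / 2 ^ (m + 2)))
    rw [abs_le]
    constructor <;> nlinarith
  set a : Pt 3 := u - x - emb ((2 : ℤ) ^ m • y) with ha
  set v : Z3 := (⌊a 0 / 2 ^ (m + 2)⌋, ⌊a 1 / 2 ^ (m + 2)⌋, ⌊a 2 / 2 ^ (m + 2)⌋) with hv
  set τ : Z3 := (2 : ℤ) ^ m • y + (2 : ℤ) ^ (m + 2) • v with hτ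
  have hτlink : ∀ d e, hatLink τ d e ↔ dirRel R d e := fun d e => by
    rw [hτ, hatLink_periodic hy, hlink]
  have hτ0 : τ ≠ 0 := fun h0 => by
    obtain ⟨d, e, hde⟩ := exists_dirRel hR
    rw [← hτlink, h0] at hde
    exact not_hatLink_zero d e hde
  refine ⟨x + emb τ, ?_, ballIso_add_emb (T := hatRTrace P R) (hatTrace_segs hC3 hH hP)
    (fun S S' => hatRTrace_conn_iff hC3 hH hP hR) x r τ fun p d e hp => ?_⟩
  · have : x + emb τ - u = ((2 ^ (m + 2) : ℤ) : ℝ) • emb v - a := by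
      rw [hτ, emb_add, emb_zsmul _ v, ha]
      abel
    rw [mem_closedBall_iff_norm, this]
    refine (norm_le_sum_abs _).trans ?_
    have h0 := hfloor (a 0)
    have h1 := hfloor (a 1)
    have h2 := hfloor (a 2)
    simp only [PiLp.sub_apply, PiLp.smul_apply, emb_apply_zero, emb_apply_one, emb_apply_two,
      smul_eq_mul, hv, Int.cast_pow, Int.cast_ofNat]
    linarith
  · by_cases hp0 : p = 0
    · rw [hp0, zero_add, fullLink_of_ne_zero hτ0, fullLink_zero, hτlink]
    have hlt : ∀ i, |emb p i| < 2 ^ s := fun i => by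
      rw [mem_closedBall_iff_norm] at hp
      have h1 := norm_le_norm_add_norm_sub' (emb p) x
      linarith [abs_apply_le_norm (emb p) i]
    have h0 : |(p.1 : ℝ)| < 2 ^ s := hlt 0
    have h1 : |(p.2.1 : ℝ)| < 2 ^ s := hlt 1
    have h2 : |(p.2.2 : ℝ)| < 2 ^ s := hlt 2
    norm_cast at h0 h1 h2
    obtain ⟨k, hk, q, hq, rfl⟩ := exists_eq_pow_zsmul s hp0 h0 h1 h2
    obtain ⟨n, rfl⟩ := Nat.exists_eq_add_of_le (show k + 2 ≤ m by omega)
    have hτ' : τ = (2 : ℤ) ^ (k + 2) • ((2 : ℤ) ^ n • y + (2 : ℤ) ^ (n + 2) • v) := by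
      rw [smul_add, smul_smul, smul_smul, ← pow_add, ← pow_add, ← add_assoc (k + 2)]
    have hne : (2 : ℤ) ^ k • q + τ ≠ 0 := by
      intro h0
      rw [hτ', pow_add, mul_smul, ← smul_add, smul_eq_zero_iff_right (by positivity)] at h0
      apply hq
      rw [← red_add_four_zsmul q, show (4 : ℤ) = 2 ^ 2 by norm_num, h0]
      decide
    rw [fullLink_of_ne_zero hne, fullLink_of_ne_zero hp0, hτ', hatLink_periodic hq]

/-- Theorem 2.7: `Ĉ_R` satisfies the local isomorphism property if
and only if `R` satisfies (P). -/
theorem statement14 (C3 : Set (Curve 3)) (hC3 : traceOf C3 = CTrace)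
    (hH : SatH C3 2 4) (P : ℕ → Set (Curve 3)) (hP : PowersOf C3 2 P)
    (R : Pt 3 → Pt 3 → Prop) (hR : IsPairing R) :
    LocIsoProp (hatRTrace P R) ↔ SatP P R := by
  rw [satP_iff hC3 hH hP hR]
  constructor
  · intro h
    obtain ⟨w, hw, hev, hlink⟩ := exists_hatLink_of_locIsoProp hC3 hH hP hR h
    simpa only [hlink] using exists_hatLink_eq hw hev
  · rintro ⟨y, -, hy, h | h⟩
    · refine locIsoProp_of_forall_hatLink hC3 hH hP hR hy fun s => ⟨2 * s + 1, by omega, ?_⟩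
      simpa only [hatLink_pow_odd] using h
    · refine locIsoProp_of_forall_hatLink hC3 hH hP hR hy fun s => ⟨2 * s + 2, by omega, ?_⟩
      simp only [hatLink_pow_succ_succ, hatLink_pow_odd, h, thetaDir_thetaDir, implies_true]

end
end Folding
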